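/- arXiv:1011.0460 — 15 statements merged into one kernel-verified Lean document; each statement's English description precedes it below -/
import Mathlib

section
/- Let k be a field and C a finite-dimensional coalgebra over k. A k-linear map φ : C → C is a left-comodule endomorphism of C (i.e. (id ⊗ φ) ∘ Δ = Δ ∘ φ) if and only if φ commutes under composition with every right-comodule endomorphism of C (i.e. φ ∘ ψ = ψ ∘ φ for every k-linear ψ : C → C satisfying (ψ ⊗ id) ∘ Δ = Δ ∘ ψ). -/
open scoped TensorProduct

/-- Over a field, the maps `f ⊗ id` for `f` in the dual of `M` jointly separate the points
of `M ⊗ N`. -/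
theorem TensorProduct.ext_of_dual_rTensor {k M N : Type*} [Field k] [AddCommGroup M]
    [Module k M] [AddCommGroup N] [Module k N] {x y : M ⊗[k] N}
    (h : ∀ f : M →ₗ[k] k, f.rTensor N x = f.rTensor N y) : x = y := by
  classical
  let b := Module.Basis.ofVectorSpace k M
  apply (TensorProduct.equivFinsuppOfBasisLeft (N := N) b).injective
  ext i
  rw [TensorProduct.equivFinsuppOfBasisLeft_apply, TensorProduct.equivFinsuppOfBasisLeft_apply,
    h (b.coord i)]

/-- The convolution `c ↦ ∑ f(c₁) c₂` of a linear form with the identity. -/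
noncomputable def Coalgebra.leftContract {k C : Type*} [Field k] [AddCommGroup C] [Module k C]
    [Coalgebra k C] (f : C →ₗ[k] k) : C →ₗ[k] C :=
  (TensorProduct.lid k C).toLinearMap ∘ₗ f.rTensor C ∘ₗ Coalgebra.comul

theorem Coalgebra.leftContract_apply {k C : Type*} [Field k] [AddCommGroup C] [Module k C]
    [Coalgebra k C] (f : C →ₗ[k] k) (c : C) :
    Coalgebra.leftContract f c =
      TensorProduct.lid k C (f.rTensor C (Coalgebra.comul (R := k) c)) := rfl

theorem Coalgebra.map_leftContract_comp_comul {k C : Type*} [Field k] [AddCommGroup C]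
    [Module k C] [Coalgebra k C] (f : C →ₗ[k] k) :
    (_root_.TensorProduct.map (leftContract f) LinearMap.id).comp (comul (R := k)) =
      (comul (R := k)).comp (leftContract f) := by
  have hl : ∀ z : (C ⊗[k] C) ⊗[k] C,
      _root_.TensorProduct.map ((TensorProduct.lid k C).toLinearMap ∘ₗ f.rTensor C) LinearMap.id z =
        TensorProduct.lid k (C ⊗[k] C)
          (f.rTensor (C ⊗[k] C) (_root_.TensorProduct.assoc k C C C z)) := by
    intro z
    induction z with
    | zero => simp
    | add a b ha hb => simp only [map_add, ha, hb]
    | tmul a c =>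
      induction a with
      | zero => simp
      | add a b ha hb => simp only [map_add, TensorProduct.add_tmul, ha, hb]
      | tmul a b => simp [TensorProduct.smul_tmul']
  have hr : ∀ z : C ⊗[k] C,
      comul (R := k) (TensorProduct.lid k C (f.rTensor C z)) =
        TensorProduct.lid k (C ⊗[k] C)
          (f.rTensor (C ⊗[k] C) ((comul (R := k)).lTensor C z)) := by
    intro z
    induction z with
    | zero => simp
    | add a b ha hb => simp only [map_add, ha, hb]
    | tmul a b => simp
  ext c
  have hm : _root_.TensorProduct.map (leftContract f) LinearMap.id (comul (R := k) c) =
      _root_.TensorProduct.map ((TensorProduct.lid k C).toLinearMap ∘ₗ f.rTensor C) LinearMap.id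
        ((comul (R := k)).rTensor C (comul (R := k) c)) := by
    change (leftContract f).rTensor C _ = LinearMap.rTensor C (_ ∘ₗ _) _
    rw [← LinearMap.rTensor_comp_apply]
    rfl
  rw [LinearMap.comp_apply, LinearMap.comp_apply, hm, hl, coassoc_apply, leftContract_apply, hr]

/-- Every right-comodule endomorphism `ψ` is the contraction against `ε ∘ ψ`. -/
theorem Coalgebra.eq_leftContract_counit_comp {k C : Type*} [Field k] [AddCommGroup C]
    [Module k C] [Coalgebra k C] {ψ : C →ₗ[k] C}
    (hψ : (_root_.TensorProduct.map ψ LinearMap.id).comp (comul (R := k)) =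
      (comul (R := k)).comp ψ) :
    ψ = leftContract ((counit (R := k)).comp ψ) := by
  ext c
  have h := LinearMap.congr_fun hψ c
  rw [LinearMap.comp_apply, LinearMap.comp_apply] at h
  rw [leftContract_apply, LinearMap.rTensor_comp, LinearMap.comp_apply,
    LinearMap.rTensor, LinearMap.rTensor, h, ← LinearMap.rTensor, rTensor_counit_comul]
  simp

theorem Coalgebra.apply_leftContract {k C : Type*} [Field k] [AddCommGroup C] [Module k C]
    [Coalgebra k C] (φ : C →ₗ[k] C) (f : C →ₗ[k] k) (c : C) :
    φ (leftContract f c) =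
      TensorProduct.lid k C
        (f.rTensor C (_root_.TensorProduct.map LinearMap.id φ (comul (R := k) c))) := by
  rw [leftContract_apply]
  induction comul (R := k) c with
  | zero => simp
  | add a b ha hb => simp only [map_add, ha, hb]
  | tmul a b => simp

/-- A linear map `φ : C → C` on a finite-dimensional coalgebra `C` over a field `k` is a
left-comodule endomorphism (`(id ⊗ φ) ∘ Δ = Δ ∘ φ`) if and only if it commutes under
composition with every right-comodule endomorphism of `C`
(`ψ` with `(ψ ⊗ id) ∘ Δ = Δ ∘ ψ`). -/
theorem stmt1 (k C : Type*) [Field k] [AddCommGroup C] [Module k C]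
    [FiniteDimensional k C] [Coalgebra k C] (φ : C →ₗ[k] C) :
    (TensorProduct.map LinearMap.id φ).comp (Coalgebra.comul (R := k)) =
      (Coalgebra.comul (R := k)).comp φ ↔
    ∀ ψ : C →ₗ[k] C,
      (TensorProduct.map ψ LinearMap.id).comp (Coalgebra.comul (R := k)) =
        (Coalgebra.comul (R := k)).comp ψ →
      φ.comp ψ = ψ.comp φ := by
  constructor
  · intro hφ ψ hψ
    rw [Coalgebra.eq_leftContract_counit_comp hψ]
    ext c
    have h := LinearMap.congr_fun hφ c
    rw [LinearMap.comp_apply, LinearMap.comp_apply] at h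
    rw [LinearMap.comp_apply, LinearMap.comp_apply, Coalgebra.apply_leftContract, h,
      Coalgebra.leftContract_apply]
  · intro H
    ext c
    refine TensorProduct.ext_of_dual_rTensor fun f => (TensorProduct.lid k C).injective ?_
    have h := LinearMap.congr_fun (H _ (Coalgebra.map_leftContract_comp_comul f)) c
    rw [LinearMap.comp_apply, LinearMap.comp_apply, Coalgebra.apply_leftContract,
      Coalgebra.leftContract_apply] at h
    exact h
end

section
/- Let k be a field, D a finite-dimensional coalgebra over k, and D* its convolution algebra. Then every two-sided ideal I of D* is the annihilator of a subcoalgebra of D: there exists a k-subspace C ⊆ D with Δ(C) contained in the image of C ⊗[k] C in D ⊗[k] D, such that I = {α ∈ D* : α(c) = 0 for all c ∈ C}. Consequently, for every surjective k-algebra homomorphism π : D* → L onto a k-algebra L there is a subcoalgebra C of D such that ker π equals the annihilator of C, so L is isomorphic as a k-algebra to the convolution algebra C* via the restriction map D* → C*. -/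
open scoped TensorProduct

universe u v

/-- The convolution product on the dual of a coalgebra: `(α * β)(c) = (α ⊗ β)(Δ c)`. -/
noncomputable def convMul {k D : Type*} [CommSemiring k] [AddCommMonoid D] [Module k D]
    [Coalgebra k D] (α β : D →ₗ[k] k) : D →ₗ[k] k :=
  (LinearMap.mul' k k).comp ((TensorProduct.map α β).comp (Coalgebra.comul (R := k)))

/-- A subspace `C` of a coalgebra `D` is a subcoalgebra if `Δ(C)` is contained in the image
of `C ⊗ C` in `D ⊗ D`. -/
def IsSubcoalgebra {k D : Type*} [CommSemiring k] [AddCommMonoid D] [Module k D]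
    [Coalgebra k D] (C : Submodule k D) : Prop :=
  ∀ c ∈ C, Coalgebra.comul (R := k) c ∈
    LinearMap.range (TensorProduct.map C.subtype C.subtype)

/-- Pairs of linear functionals separate the points of `D ⊗ D`. -/
theorem tensor_eq_zero_of_forall_dual {k D : Type*} [Field k] [AddCommGroup D] [Module k D]
    (s : D ⊗[k] D)
    (h : ∀ α β : D →ₗ[k] k, LinearMap.mul' k k (TensorProduct.map α β s) = 0) : s = 0 := by
  let b := Module.Basis.ofVectorSpace k D
  refine (b.tensorProduct b).ext_elem fun ij => ?_
  have key : (b.tensorProduct b).coord ij =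
      LinearMap.mul' k k ∘ₗ TensorProduct.map (b.coord ij.1) (b.coord ij.2) := by
    ext x y
    exact (b.tensorProduct_repr_tmul_apply b x y ij.1 ij.2).trans (mul_comm _ _)
  rw [map_zero, Finsupp.zero_apply, ← h (b.coord ij.1) (b.coord ij.2)]
  exact LinearMap.congr_fun key s

theorem isSubcoalgebra_dualCoannihilator {k D : Type*} [Field k] [AddCommGroup D] [Module k D]
    [FiniteDimensional k D] [Coalgebra k D] (I : Submodule k (D →ₗ[k] k))
    (hI : ∀ α ∈ I, ∀ β : D →ₗ[k] k, convMul α β ∈ I ∧ convMul β α ∈ I) :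
    IsSubcoalgebra (Submodule.dualCoannihilator (R := k) (M := D) I) := by
  set C := Submodule.dualCoannihilator (R := k) (M := D) I
  intro c hc
  obtain ⟨p, hp⟩ := C.subtype.exists_leftInverse_of_injective C.ker_subtype
  have hq : ∀ α : D →ₗ[k] k, α - α ∘ₗ C.subtype ∘ₗ p ∈ I := by
    intro α
    have : α - α ∘ₗ C.subtype ∘ₗ p ∈ Submodule.dualAnnihilator C := by
      rw [Submodule.mem_dualAnnihilator]
      intro w hw
      have hpw : p w = ⟨w, hw⟩ := LinearMap.congr_fun hp ⟨w, hw⟩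
      simp [hpw]
    exact (Subspace.dualCoannihilator_dualAnnihilator_eq (W := I)).le this
  have hzero : ∀ α ∈ I, α c = 0 := (Submodule.mem_dualCoannihilator c).1 hc
  set t := Coalgebra.comul (R := k) c with ht
  have hleft : TensorProduct.map (C.subtype ∘ₗ p) LinearMap.id t = t := by
    rw [eq_comm, ← sub_eq_zero]
    refine tensor_eq_zero_of_forall_dual _ fun α β => ?_
    have h := hzero _ (hI _ (hq α) β).1
    have hsub : TensorProduct.map (α - α ∘ₗ C.subtype ∘ₗ p) β = TensorProduct.map α β -
        TensorProduct.map (α ∘ₗ C.subtype ∘ₗ p) β := by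
      ext x y
      simp [TensorProduct.sub_tmul]
    simpa [convMul, hsub, TensorProduct.map_map, ← ht] using h
  have hright : TensorProduct.map LinearMap.id (C.subtype ∘ₗ p) t = t := by
    rw [eq_comm, ← sub_eq_zero]
    refine tensor_eq_zero_of_forall_dual _ fun α β => ?_
    have h := hzero _ (hI _ (hq β) α).2
    have hsub : TensorProduct.map α (β - β ∘ₗ C.subtype ∘ₗ p) = TensorProduct.map α β -
        TensorProduct.map α (β ∘ₗ C.subtype ∘ₗ p) := by
      ext x y
      simp [TensorProduct.tmul_sub]
    simpa [convMul, hsub, TensorProduct.map_map, ← ht] using h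
  refine ⟨TensorProduct.map p p t, ?_⟩
  conv_rhs => rw [← hleft, ← hright]
  simp [TensorProduct.map_map]

theorem exists_isSubcoalgebra_of_ideal {k D : Type*} [Field k] [AddCommGroup D] [Module k D]
    [FiniteDimensional k D] [Coalgebra k D] (I : Submodule k (D →ₗ[k] k))
    (hI : ∀ α ∈ I, ∀ β : D →ₗ[k] k, convMul α β ∈ I ∧ convMul β α ∈ I) :
    ∃ C : Submodule k D, IsSubcoalgebra C ∧
      ∀ α : D →ₗ[k] k, α ∈ I ↔ ∀ c ∈ C, α c = 0 := by
  refine ⟨_, isSubcoalgebra_dualCoannihilator I hI, fun α => ?_⟩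
  rw [← Submodule.mem_dualAnnihilator, Subspace.dualCoannihilator_dualAnnihilator_eq]

/-- A surjection from the dual of `D` whose kernel is the annihilator of `C` identifies its target
with the dual of `C`, via restriction of functionals. -/
theorem exists_equiv_dual_of_ker_eq {k D L : Type*} [Field k] [AddCommGroup D] [Module k D]
    [AddCommGroup L] [Module k L] (π : (D →ₗ[k] k) →ₗ[k] L) (hπ : Function.Surjective π)
    (C : Submodule k D) (hC : ∀ α : D →ₗ[k] k, π α = 0 ↔ ∀ c ∈ C, α c = 0) :
    ∃ e : L ≃ₗ[k] (C →ₗ[k] k), ∀ α : D →ₗ[k] k, e (π α) = α.comp C.subtype := by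
  let r : (D →ₗ[k] k) →ₗ[k] (C →ₗ[k] k) := C.dualRestrict
  have hr : Function.Surjective r := Subspace.dualRestrict_surjective
  have hker : LinearMap.ker π = LinearMap.ker r := by
    ext α
    rw [LinearMap.mem_ker, hC]
    exact (Submodule.mem_dualAnnihilator α).symm
  refine ⟨(π.quotKerEquivOfSurjective hπ).symm ≪≫ₗ Submodule.quotEquivOfEq _ _ hker ≪≫ₗ
    r.quotKerEquivOfSurjective hr, fun α => ?_⟩
  have : (π.quotKerEquivOfSurjective hπ).symm (π α) = Submodule.Quotient.mk α := by
    rw [LinearEquiv.symm_apply_eq]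
    rfl
  rw [LinearEquiv.trans_apply, LinearEquiv.trans_apply, this]
  rfl

/-- For a finite-dimensional coalgebra `D` over a field `k`:
every two-sided ideal of the convolution algebra `D*` is the annihilator of a subcoalgebra
of `D`; consequently, every surjective `k`-algebra homomorphism `π : D* → L` has kernel the
annihilator of a subcoalgebra `C` of `D`, and `L` is isomorphic to `C*` via the restriction
map `D* → C*`. -/
theorem stmt2 (k D : Type u) [Field k] [AddCommGroup D] [Module k D] [FiniteDimensional k D]
    [Coalgebra k D] :
    (∀ I : Submodule k (D →ₗ[k] k),
      (∀ α ∈ I, ∀ β : D →ₗ[k] k, convMul α β ∈ I ∧ convMul β α ∈ I) →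
      ∃ C : Submodule k D, IsSubcoalgebra C ∧
        ∀ α : D →ₗ[k] k, α ∈ I ↔ ∀ c ∈ C, α c = 0) ∧
    (∀ (L : Type v) [Ring L] [Algebra k L] (π : (D →ₗ[k] k) →ₗ[k] L),
      Function.Surjective π →
      (∀ α β : D →ₗ[k] k, π (convMul α β) = π α * π β) →
      π (Coalgebra.counit (R := k)) = 1 →
      ∃ C : Submodule k D, IsSubcoalgebra C ∧
        (∀ α : D →ₗ[k] k, π α = 0 ↔ ∀ c ∈ C, α c = 0) ∧
        ∃ e : L ≃ₗ[k] (C →ₗ[k] k), ∀ α : D →ₗ[k] k, e (π α) = α.comp C.subtype) := by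
  refine ⟨exists_isSubcoalgebra_of_ideal, fun L _ _ π hπ hmul _ => ?_⟩
  obtain ⟨C, hC, hker⟩ := exists_isSubcoalgebra_of_ideal (LinearMap.ker π) fun α hα β => by
    simp [LinearMap.mem_ker, hmul, LinearMap.mem_ker.1 hα]
  exact ⟨C, hC, hker, exists_equiv_dual_of_ker_eq π hπ C hker⟩
end

section
/- Let k be a field, V and W vector spaces over k, and ψ : V → W an injective k-linear map. If t ∈ V ⊗[k] V is such that (ψ ⊗ ψ)(t) ∈ W ⊗[k] W can be written as a sum of at most m simple tensors, then t can be written as a sum of at most m simple tensors in V ⊗[k] V. -/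
open scoped TensorProduct

/-- If `ψ : V → W` is an injective linear map and `(ψ ⊗ ψ)(t)` can be written as a sum of at
most `m` simple tensors in `W ⊗ W`, then `t` can be written as a sum of at most `m` simple
tensors in `V ⊗ V`. -/
theorem stmt4 (k V W : Type*) [Field k] [AddCommGroup V] [Module k V]
    [AddCommGroup W] [Module k W] (ψ : V →ₗ[k] W) (hψ : Function.Injective ψ)
    (t : V ⊗[k] V) (m : ℕ)
    (h : ∃ (x y : Fin m → W), TensorProduct.map ψ ψ t = ∑ j, x j ⊗ₜ[k] y j) :
    ∃ (x y : Fin m → V), t = ∑ j, x j ⊗ₜ[k] y j := by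
  obtain ⟨x, y, hxy⟩ := h
  obtain ⟨φ, hφ⟩ := ψ.exists_leftInverse_of_injective (LinearMap.ker_eq_bot.mpr hψ)
  refine ⟨φ ∘ x, φ ∘ y, ?_⟩
  calc t = TensorProduct.map φ φ (TensorProduct.map ψ ψ t) := by
        rw [← LinearMap.comp_apply, ← TensorProduct.map_comp, hφ, TensorProduct.map_id,
          LinearMap.id_apply]
    _ = ∑ j, (φ ∘ x) j ⊗ₜ[k] (φ ∘ y) j := by
        simp [hxy]
end

section
/- Let k be a field, L an associative unital k-algebra (not necessarily commutative), m ∈ ℕ, and I a two-sided ideal of L with dim_k(L/I) = m. Let α : L → k be a k-linear functional vanishing on I. Then there exist k-linear functionals β_1, …, β_m and γ_1, …, γ_m : L → k, each of which vanishes on some two-sided ideal of L of codimension at most m, such that α(x * y) = Σ_{i=1}^m β_i(x) · γ_i(y) for all x, y ∈ L. -/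
/-- Let `L` be an associative unital `k`-algebra, `I` a two-sided ideal of `L` with
`dim_k (L/I) = m`, and `α : L → k` a linear functional vanishing on `I`.  Then there are
functionals `β i`, `γ i` (`i = 1, …, m`), each vanishing on some two-sided ideal of
codimension at most `m`, with `α (x * y) = ∑ i, β i x * γ i y` for all `x, y`. -/
theorem stmt5 (k L : Type*) [Field k] [Ring L] [Algebra k L] (m : ℕ)
    (I : Submodule k L) (hI : ∀ x ∈ I, ∀ a : L, a * x ∈ I ∧ x * a ∈ I)
    (hdim : Module.rank k (L ⧸ I) = m)
    (α : L →ₗ[k] k) (hα : ∀ x ∈ I, α x = 0) :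
    ∃ β γ : Fin m → (L →ₗ[k] k),
      (∀ i, ∃ J : Submodule k L, (∀ x ∈ J, ∀ a : L, a * x ∈ J ∧ x * a ∈ J) ∧
          Module.rank k (L ⧸ J) ≤ m ∧ ∀ x ∈ J, β i x = 0) ∧
      (∀ i, ∃ J : Submodule k L, (∀ x ∈ J, ∀ a : L, a * x ∈ J ∧ x * a ∈ J) ∧
          Module.rank k (L ⧸ J) ≤ m ∧ ∀ x ∈ J, γ i x = 0) ∧
      (∀ x y : L, α (x * y) = ∑ i, β i x * γ i y) := by
  have : Module.Finite k (L ⧸ I) :=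
    Module.rank_lt_aleph0_iff.mp (hdim ▸ Cardinal.natCast_lt_aleph0)
  let b : Module.Basis (Fin m) k (L ⧸ I) :=
    Module.finBasisOfFinrankEq k (L ⧸ I) (Module.finrank_eq_of_rank_eq hdim)
  choose e he using fun i => I.mkQ_surjective (b i)
  refine ⟨fun i => α ∘ₗ LinearMap.mulRight k (e i), fun i => b.coord i ∘ₗ I.mkQ,
    fun i => ⟨I, hI, hdim.le, fun x hx => hα _ (hI x hx (e i)).2⟩,
    fun i => ⟨I, hI, hdim.le, fun x hx => ?_⟩, fun x y => ?_⟩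
  · simp [(Submodule.Quotient.mk_eq_zero I).mpr hx]
  · have hy : y - ∑ i, b.coord i (I.mkQ y) • e i ∈ I := by
      rw [← Submodule.Quotient.mk_eq_zero, ← Submodule.mkQ_apply, map_sub, map_sum, sub_eq_zero]
      simp only [map_smul, he, Module.Basis.coord_apply, b.sum_repr]
    have h := hα _ (hI _ hy x).1
    rw [mul_sub, map_sub, sub_eq_zero, Finset.mul_sum, map_sum] at h
    rw [h]
    refine Finset.sum_congr rfl fun i _ => ?_
    rw [mul_smul_comm, map_smul, smul_eq_mul, mul_comm]
    rfl
end

section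
/- Let k be a field and A, B Hopf algebras over k. Let a : Fin n → Fin n → A satisfy ε_A(a i j) = δ_{ij} and Δ_A(a i j) = Σ_l (a i l) ⊗ (a l j) for all i, j, and let b : Fin n → Fin n → B satisfy the analogous identities over B. Equip A ⊗[k] B with its standard bialgebra structure (Δ_{A⊗B} = (id ⊗ τ ⊗ id) ∘ (Δ_A ⊗ Δ_B) where τ is the twist, and ε_{A⊗B} = ε_A ⊗ ε_B). Define z i j := Σ_l (a i l) ⊗ₜ (b l j) ∈ A ⊗[k] B. Then ε_{A⊗B}(z i j) = δ_{ij} for all i, j, and the identities Δ_{A⊗B}(z i j) = Σ_l (z i l) ⊗ (z l j) hold for all i, j if and only if the two matrices (i, j) ↦ (a i j) ⊗ₜ 1 and (i, j) ↦ 1 ⊗ₜ (b i j) commute in the matrix ring Matrix (Fin n) (Fin n) (A ⊗[k] B). -/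
open scoped TensorProduct

universe u

namespace ComoduleCoefficients

open TensorProduct

variable {k A B ι : Type*} [Field k] [Ring A] [Ring B] [HopfAlgebra k A] [HopfAlgebra k B]
  [Fintype ι] {a : ι → ι → A} {b : ι → ι → B}

variable (k) in
/-- The matrices `(a i j ⊗ 1)` and `(1 ⊗ b i j)` commute iff the sums
`∑ l, a i l ⊗ b l j` and `∑ l, a l j ⊗ b i l` agree. -/
lemma commute_iff (a : ι → ι → A) (b : ι → ι → B) :
    Commute (Matrix.of fun i j => (a i j) ⊗ₜ[k] (1 : B))
        (Matrix.of fun i j => (1 : A) ⊗ₜ[k] (b i j)) ↔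
      ∀ i j, ∑ l, a i l ⊗ₜ[k] b l j = ∑ l, a l j ⊗ₜ[k] b i l := by
  simp [commute_iff_eq, ← Matrix.ext_iff, Matrix.mul_apply]

variable (k A B) in
/-- The map `(x ⊗ y) ⊗ (x' ⊗ y') ↦ ε(x) ε(y') (x' ⊗ y)`. -/
noncomputable def outerCounit : (A ⊗[k] B) ⊗[k] (A ⊗[k] B) →ₗ[k] A ⊗[k] B :=
  (TensorProduct.comm k B A).toLinearMap ∘ₗ
    TensorProduct.map
      ((TensorProduct.lid k B).toLinearMap ∘ₗ Coalgebra.counit.rTensor B)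
      ((TensorProduct.rid k A).toLinearMap ∘ₗ Coalgebra.counit.lTensor A)

lemma outerCounit_tmul (x x' : A) (y y' : B) :
    outerCounit k A B ((x ⊗ₜ y) ⊗ₜ (x' ⊗ₜ y')) =
      Coalgebra.counit (R := k) x • Coalgebra.counit (R := k) y' • (x' ⊗ₜ[k] y) := by
  simp [outerCounit, smul_tmul', tmul_smul, smul_comm (Coalgebra.counit (R := k) x)]

/-- The map `x' ⊗ y ↦ (x ⊗ y) ⊗ (x' ⊗ y')`. -/
noncomputable def insertOuter (x : A) (y' : B) :
    A ⊗[k] B →ₗ[k] (A ⊗[k] B) ⊗[k] (A ⊗[k] B) :=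
  TensorProduct.map (TensorProduct.mk k A B x) ((TensorProduct.mk k A B).flip y') ∘ₗ
    (TensorProduct.comm k A B).toLinearMap

lemma insertOuter_tmul (x x' : A) (y y' : B) :
    insertOuter (k := k) x y' (x' ⊗ₜ y) = (x ⊗ₜ y) ⊗ₜ (x' ⊗ₜ y') := by
  simp [insertOuter]

lemma sum_sum_sum_reverse {M : Type*} [AddCommMonoid M] (f : ι → ι → ι → M) :
    ∑ x, ∑ y, ∑ z, f x y z = ∑ z, ∑ y, ∑ x, f x y z := by
  rw [Finset.sum_congr rfl fun _ _ => Finset.sum_comm, Finset.sum_comm]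
  exact Finset.sum_congr rfl fun _ _ => Finset.sum_comm

lemma comul_sum_tmul
    (ha : ∀ i j, Coalgebra.comul (R := k) (a i j) = ∑ l, a i l ⊗ₜ[k] a l j)
    (hb : ∀ i j, Coalgebra.comul (R := k) (b i j) = ∑ l, b i l ⊗ₜ[k] b l j) (i j : ι) :
    Coalgebra.comul (R := k) (∑ l, a i l ⊗ₜ[k] b l j) =
      ∑ p, ∑ q, insertOuter (a i p) (b q j) (∑ l, a p l ⊗ₜ[k] b l q) := by
  simp only [map_sum, TensorProduct.comul_tmul, ha, hb, sum_tmul, tmul_sum,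
    AlgebraTensorModule.tensorTensorTensorComm_tmul, insertOuter_tmul]
  exact sum_sum_sum_reverse _

lemma sum_sum_tmul_sum (a : ι → ι → A) (b : ι → ι → B) (i j : ι) :
    ∑ l, (∑ l', a i l' ⊗ₜ[k] b l' l) ⊗ₜ[k] (∑ l', a l l' ⊗ₜ[k] b l' j) =
      ∑ p, ∑ q, insertOuter (a i p) (b q j) (∑ l, a l q ⊗ₜ[k] b p l) := by
  simp only [map_sum, sum_tmul, tmul_sum, insertOuter_tmul]
  exact sum_sum_sum_reverse _

lemma outerCounit_sum_sum_insertOuter [DecidableEq ι]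
    (ha : ∀ i j, Coalgebra.counit (R := k) (a i j) = if i = j then (1 : k) else 0)
    (hb : ∀ i j, Coalgebra.counit (R := k) (b i j) = if i = j then (1 : k) else 0)
    (t : ι → ι → A ⊗[k] B) (i j : ι) :
    outerCounit k A B (∑ p, ∑ q, insertOuter (a i p) (b q j) (t p q)) = t i j := by
  have h (x : A) (y : B) (s : A ⊗[k] B) : outerCounit k A B (insertOuter x y s) =
      Coalgebra.counit (R := k) x • Coalgebra.counit (R := k) y • s := by
    induction s with
    | zero => simp
    | add s₁ s₂ h₁ h₂ => simp only [map_add, smul_add, h₁, h₂]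
    | tmul x' y' => rw [insertOuter_tmul, outerCounit_tmul]
  simp [h, ha, hb]

end ComoduleCoefficients

/-- Given coefficient matrices `a`, `b` of `n`-dimensional comodules over Hopf algebras `A`
and `B`, the matrix `z i j := ∑ l, a i l ⊗ b l j` over `A ⊗ B` (with its standard bialgebra
structure) always satisfies the counit condition, and it satisfies the comultiplication
condition `Δ(z i j) = ∑ l, z i l ⊗ z l j` if and only if the matrices
`(a i j ⊗ 1)` and `(1 ⊗ b i j)` commute in the matrix ring over `A ⊗ B`. -/
theorem stmt7 (k A B : Type u) [Field k] [Ring A] [Ring B]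
    [HopfAlgebra k A] [HopfAlgebra k B] (n : ℕ)
    (a : Fin n → Fin n → A) (b : Fin n → Fin n → B)
    (ha1 : ∀ i j, Coalgebra.counit (R := k) (a i j) = if i = j then (1 : k) else 0)
    (ha2 : ∀ i j, Coalgebra.comul (R := k) (a i j) = ∑ l, a i l ⊗ₜ[k] a l j)
    (hb1 : ∀ i j, Coalgebra.counit (R := k) (b i j) = if i = j then (1 : k) else 0)
    (hb2 : ∀ i j, Coalgebra.comul (R := k) (b i j) = ∑ l, b i l ⊗ₜ[k] b l j) :
    (∀ i j, Coalgebra.counit (R := k) (∑ l, a i l ⊗ₜ[k] b l j) =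
      if i = j then (1 : k) else 0) ∧
    ((∀ i j, Coalgebra.comul (R := k) (∑ l, a i l ⊗ₜ[k] b l j) =
        ∑ l, (∑ l', a i l' ⊗ₜ[k] b l' l) ⊗ₜ[k] (∑ l', a l l' ⊗ₜ[k] b l' j)) ↔
      Commute (Matrix.of fun i j => (a i j) ⊗ₜ[k] (1 : B))
        (Matrix.of fun i j => (1 : A) ⊗ₜ[k] (b i j))) := by
  refine ⟨fun i j => ?_, ?_⟩
  · simp [ha1, hb1]
  simp only [ComoduleCoefficients.commute_iff,
    ComoduleCoefficients.comul_sum_tmul ha2 hb2, ComoduleCoefficients.sum_sum_tmul_sum]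
  refine ⟨fun h i j => ?_, fun h i j => by simp only [h]⟩
  simpa only [ComoduleCoefficients.outerCounit_sum_sum_insertOuter ha1 hb1
    (fun p q => ∑ l, a p l ⊗ₜ[k] b l q),
    ComoduleCoefficients.outerCounit_sum_sum_insertOuter ha1 hb1
    (fun p q => ∑ l, a l q ⊗ₜ[k] b p l)] using
    congrArg (ComoduleCoefficients.outerCounit k A B) (h i j)
end

section
/- Let k be a field, n ∈ ℕ, and c : ℕ → Matrix (Fin n) (Fin n) k a finitely supported family of matrices. For a polynomial t, write M(t) for the matrix Σ_r t^r • (c_r mapped into matrices over the polynomial ring). Then the identity M(s + t) = M(s) * M(t) holds in Matrix (Fin n) (Fin n) (MvPolynomial (Fin 2) k), where s and t are the two polynomial variables, if and only if c_r * c_s = ((r+s).choose r : k) • c_{r+s} for all r, s ∈ ℕ. Consequently, c defines an n-dimensional polynomial representation of the additive group G_a over k (meaning additionally M(0) = 1, i.e. c_0 = 1) if and only if c_0 = 1 and the fundamental relation c_r * c_s = ((r+s).choose r : k) • c_{r+s} holds for all r, s. -/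
/-- The matrix `M(t) = ∑ r, t^r • c_r` over the polynomial ring. -/
noncomputable def gaM (k : Type*) [Field k] (n : ℕ) (c : ℕ → Matrix (Fin n) (Fin n) k)
    (t : MvPolynomial (Fin 2) k) : Matrix (Fin n) (Fin n) (MvPolynomial (Fin 2) k) :=
  ∑ᶠ r : ℕ, t ^ r • (c r).map (MvPolynomial.C : k →+* MvPolynomial (Fin 2) k)

theorem gaM_apply {k : Type*} [Field k] {n : ℕ} {c : ℕ → Matrix (Fin n) (Fin n) k}
    (hc : (Function.support c).Finite) (t : MvPolynomial (Fin 2) k) (i j : Fin n) :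
    gaM k n c t i j = ∑ r ∈ hc.toFinset, MvPolynomial.C (c r i j) * t ^ r := by
  rw [gaM, finsum_eq_sum_of_support_subset (s := hc.toFinset), Matrix.sum_apply]
  · simp [mul_comm]
  · intro r hr
    rw [Set.Finite.coe_toFinset]
    contrapose! hr
    simp [Function.notMem_support.mp hr]

theorem gaM_zero {k : Type*} [Field k] {n : ℕ} {c : ℕ → Matrix (Fin n) (Fin n) k}
    (hc : (Function.support c).Finite) :
    gaM k n c 0 = (c 0).map (MvPolynomial.C : k →+* MvPolynomial (Fin 2) k) := by
  ext1 i j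
  rw [gaM_apply hc, Finset.sum_eq_single 0]
  · simp
  · intro r _ hr
    simp [hr]
  · intro h
    have h0 : c 0 = 0 := by simpa using h
    simp [h0]

theorem coeff_gaM_add {k : Type*} [Field k] {n : ℕ} {c : ℕ → Matrix (Fin n) (Fin n) k}
    (hc : (Function.support c).Finite) (d : Fin 2 →₀ ℕ) (i j : Fin n) :
    (gaM k n c (MvPolynomial.X 0 + MvPolynomial.X 1) i j).coeff d =
      (((d 0 + d 1).choose (d 0) : k) • c (d 0 + d 1)) i j := by
  simp only [gaM_apply hc, MvPolynomial.coeff_sum, MvPolynomial.coeff_C_mul,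
    MvPolynomial.coeff_add_pow]
  rw [Finset.sum_eq_single (d 0 + d 1)]
  · simp [mul_comm]
  · intro r _ hr
    simp [hr.symm]
  · intro h
    have h0 : c (d 0 + d 1) = 0 := by simpa using h
    simp [h0]

theorem MvPolynomial.coeff_C_mul_X_pow_mul_C_mul_X_pow {R : Type*} [CommSemiring R]
    (d : Fin 2 →₀ ℕ) (a b : R) (p q : ℕ) :
    ((C a * X 0 ^ p) * (C b * X 1 ^ q) : MvPolynomial (Fin 2) R).coeff d =
      if p = d 0 ∧ q = d 1 then a * b else 0 := by
  rw [C_mul_X_pow_eq_monomial, C_mul_X_pow_eq_monomial, monomial_mul, coeff_monomial]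
  congr 1
  simp [Finsupp.ext_iff, Fin.forall_fin_two]

theorem coeff_gaM_mul {k : Type*} [Field k] {n : ℕ} {c : ℕ → Matrix (Fin n) (Fin n) k}
    (hc : (Function.support c).Finite) (d : Fin 2 →₀ ℕ) (i j : Fin n) :
    ((gaM k n c (MvPolynomial.X 0) * gaM k n c (MvPolynomial.X 1)) i j).coeff d =
      (c (d 0) * c (d 1)) i j := by
  simp only [Matrix.mul_apply, gaM_apply hc, Finset.sum_mul_sum, MvPolynomial.coeff_sum,
    MvPolynomial.coeff_C_mul_X_pow_mul_C_mul_X_pow]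
  refine Finset.sum_congr rfl fun l _ => ?_
  rw [Finset.sum_eq_single (d 0), Finset.sum_eq_single (d 1)]
  · simp
  · intro q _ hq
    simp [hq]
  · intro h
    have h1 : c (d 1) = 0 := by simpa using h
    simp [h1]
  · intro p _ hp
    simp [hp]
  · intro h
    have h0 : c (d 0) = 0 := by simpa using h
    simp [h0]

theorem gaM_add_eq_mul_iff {k : Type*} [Field k] {n : ℕ} {c : ℕ → Matrix (Fin n) (Fin n) k}
    (hc : (Function.support c).Finite) :
    gaM k n c (MvPolynomial.X 0 + MvPolynomial.X 1) =
        gaM k n c (MvPolynomial.X 0) * gaM k n c (MvPolynomial.X 1) ↔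
      ∀ r s : ℕ, c r * c s = (((r + s).choose r : k)) • c (r + s) := by
  constructor
  · intro h r s
    ext i j
    have hd := coeff_gaM_mul hc (Finsupp.single 0 r + Finsupp.single 1 s) i j
    rw [← h, coeff_gaM_add hc] at hd
    simpa using hd.symm
  · intro h
    ext i j d
    rw [coeff_gaM_add hc, coeff_gaM_mul hc, h]

theorem gaM_zero_eq_one_iff {k : Type*} [Field k] {n : ℕ} {c : ℕ → Matrix (Fin n) (Fin n) k}
    (hc : (Function.support c).Finite) : gaM k n c 0 = 1 ↔ c 0 = 1 := by
  rw [gaM_zero hc, ← Matrix.map_one (MvPolynomial.C : k →+* MvPolynomial (Fin 2) k)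
    (map_zero _) (map_one _)]
  exact (Matrix.map_injective (MvPolynomial.C_injective (Fin 2) k)).eq_iff

/-- A finitely supported family `c` of `n × n` matrices over `k` satisfies
`M(s + t) = M(s) * M(t)` (in the two polynomial variables `s`, `t`) if and only if
`c_r * c_s = (r+s choose r) • c_(r+s)` for all `r`, `s`; and `c` defines an `n`-dimensional
polynomial representation of `G_a` (additionally `M(0) = 1`, i.e. `c_0 = 1`) if and only if
`c_0 = 1` and the fundamental relation holds. -/
theorem stmt8 (k : Type*) [Field k] (n : ℕ) (c : ℕ → Matrix (Fin n) (Fin n) k)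
    (hc : (Function.support c).Finite) :
    (gaM k n c (MvPolynomial.X 0 + MvPolynomial.X 1) =
        gaM k n c (MvPolynomial.X 0) * gaM k n c (MvPolynomial.X 1) ↔
      ∀ r s : ℕ, c r * c s = (((r + s).choose r : k)) • c (r + s)) ∧
    ((gaM k n c 0 = 1 ∧
        gaM k n c (MvPolynomial.X 0 + MvPolynomial.X 1) =
          gaM k n c (MvPolynomial.X 0) * gaM k n c (MvPolynomial.X 1)) ↔
      (c 0 = 1 ∧ ∀ r s : ℕ, c r * c s = (((r + s).choose r : k)) • c (r + s))) := by
  exact ⟨gaM_add_eq_mul_iff hc, and_congr (gaM_zero_eq_one_iff hc) (gaM_add_eq_mul_iff hc)⟩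
end

section
/- Let k be a field of characteristic zero, n ∈ ℕ, and c : ℕ → Matrix (Fin n) (Fin n) k a finitely supported family with c_0 = 1. Then c satisfies the fundamental relation c_r * c_s = ((r+s).choose r : k) • c_{r+s} for all r, s ∈ ℕ if and only if the matrix N := c_1 is nilpotent and c_r = ((r! : k))⁻¹ • N^r for every r ∈ ℕ. Equivalently: the n-dimensional polynomial representations of the additive group G_a over k are exactly the matrices e^{tN} = Σ_r ((r! : k))⁻¹ • N^r t^r for N an n×n nilpotent matrix over k. -/
/-- In any algebra, a sequence with `c 0 = 1` and `c r * c s = (r+s choose r) • c (r+s)` satisfies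
`c 1 ^ r = r! • c r`. -/
theorem pow_eq_factorial_smul_of_mul_eq_choose_smul {k A : Type*} [CommSemiring k] [Semiring A]
    [Algebra k A] (c : ℕ → A) (h0 : c 0 = 1)
    (h : ∀ r s : ℕ, c r * c s = ((r + s).choose r : k) • c (r + s)) (r : ℕ) :
    c 1 ^ r = (r.factorial : k) • c r := by
  induction r with
  | zero => simp [h0]
  | succ r ih =>
    rw [pow_succ, ih, smul_mul_assoc, h r 1, smul_smul, Nat.choose_succ_self_right,
      Nat.factorial_succ, ← Nat.cast_mul, Nat.mul_comm]

/-- Over a field of characteristic zero, a finitely supported family `c` of `n × n` matrices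
with `c_0 = 1` satisfies the fundamental relation `c_r * c_s = (r+s choose r) • c_(r+s)`
if and only if `N := c_1` is nilpotent and `c_r = (r!)⁻¹ • N^r` for all `r`; i.e. the
`n`-dimensional polynomial representations of `G_a` in characteristic zero are exactly the
matrices `e^{tN}` for `N` nilpotent. -/
theorem stmt9 (k : Type*) [Field k] [CharZero k] (n : ℕ)
    (c : ℕ → Matrix (Fin n) (Fin n) k) (hc : (Function.support c).Finite)
    (h0 : c 0 = 1) :
    (∀ r s : ℕ, c r * c s = (((r + s).choose r : k)) • c (r + s)) ↔
    (IsNilpotent (c 1) ∧ ∀ r : ℕ, c r = ((r.factorial : k))⁻¹ • (c 1) ^ r) := by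
  constructor
  · intro h
    have hpow := pow_eq_factorial_smul_of_mul_eq_choose_smul c h0 h
    refine ⟨?_, fun r => ?_⟩
    · obtain ⟨m, hm⟩ := hc.exists_notMem
      exact ⟨m, by rw [hpow m, Function.notMem_support.mp hm, smul_zero]⟩
    · rw [hpow r, inv_smul_smul₀ (Nat.cast_ne_zero.mpr r.factorial_ne_zero)]
  · rintro ⟨-, h⟩ r s
    rw [h r, h s, h (r + s), smul_mul_smul_comm, ← pow_add, smul_smul, Nat.cast_add_choose]
    congr 1
    have hr : (r.factorial : k) ≠ 0 := Nat.cast_ne_zero.mpr r.factorial_ne_zero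
    have hs : (s.factorial : k) ≠ 0 := Nat.cast_ne_zero.mpr s.factorial_ne_zero
    have hrs : ((r + s).factorial : k) ≠ 0 := Nat.cast_ne_zero.mpr (r + s).factorial_ne_zero
    field_simp
end

section
/- Let k be a field of characteristic p > 0 with p prime, n ∈ ℕ, and c : ℕ → Matrix (Fin n) (Fin n) k a finitely supported family with c_0 = 1 satisfying c_r * c_s = ((r+s).choose r : k) • c_{r+s} for all r, s ∈ ℕ. Put N_i := c_{p^i} for i ∈ ℕ. Then: (i) the matrices N_i pairwise commute; (ii) N_i^p = 0 for every i; (iii) for every r ∈ ℕ with base-p expansion r = Σ_i r_i p^i one has c_r = ((Γ_p(r) : k))⁻¹ • ∏_i N_i^{r_i}, where the finite matrix product is taken over the base-p digits in order of increasing i (the factors commute). -/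
/-- The `i`-th digit of `r` in base `p`. -/
def pDigit (p r i : ℕ) : ℕ := r / p ^ i % p

/-- `Γ_p(r)`: the product of the factorials of the base-`p` digits of `r`. -/
def gammaP (p r : ℕ) : ℕ :=
  ((List.range (r + 1)).map fun i => (pDigit p r i).factorial).prod

/-- The ordered product `∏ i, (N i) ^ (r_i)` over the base-`p` digits of `r`, taken in order
of increasing `i`. -/
def digitPow {M : Type*} [Monoid M] (p : ℕ) (N : ℕ → M) (r : ℕ) : M :=
  ((List.range (r + 1)).map fun i => N i ^ pDigit p r i).prod

theorem add_pow_mul_div_pow_mod {p m i : ℕ} (hp : 0 < p) (hi : i < m) (a d : ℕ) :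
    (a + p ^ m * d) / p ^ i % p = a / p ^ i % p := by
  obtain ⟨t, rfl⟩ := Nat.exists_eq_add_of_lt hi
  rw [show a + p ^ (i + t + 1) * d = a + p ^ i * (p * (p ^ t * d)) by ring,
    Nat.add_mul_div_left _ _ (pow_pos hp i), Nat.add_mul_mod_self_left]

/-- A case of Lucas's theorem: all base-`p` digits of `p ^ m * d` below the `m`-th vanish. -/
theorem choose_add_pow_mul_modEq_one {p : ℕ} (hp : p.Prime) {m a : ℕ} (ha : a < p ^ m) (d : ℕ) :
    (a + p ^ m * d).choose a ≡ 1 [ZMOD p] := by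
  have := Fact.mk hp
  have h := Choose.choose_modEq_choose_mul_prod_range_choose (n := a + p ^ m * d) (k := a) (p := p) m
  rw [Nat.div_eq_of_lt ha, Nat.choose_zero_right, Finset.prod_eq_one fun i hi => by
    rw [add_pow_mul_div_pow_mod hp.pos (Finset.mem_range.1 hi), Nat.choose_self]] at h
  simpa using h

theorem natCast_gammaP_ne_zero (k : Type*) [Field k] {p : ℕ} (hp : p.Prime) [CharP k p] (r : ℕ) :
    (gammaP p r : k) ≠ 0 := by
  rw [Ne, CharP.cast_eq_zero_iff k p, gammaP, hp.prime.dvd_prod_iff]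
  rintro ⟨x, hx, hdvd⟩
  obtain ⟨i, -, rfl⟩ := List.mem_map.1 hx
  exact (Nat.mod_lt _ hp.pos).not_ge (hp.dvd_factorial.1 hdvd)

section DividedPowers

variable {k A : Type*} [Field k] {p : ℕ} [CharP k p] [Ring A] [Algebra k A] {c : ℕ → A}

theorem commute_of_mul_eq_choose_smul
    (hrel : ∀ r s : ℕ, c r * c s = (((r + s).choose r : k)) • c (r + s)) (r s : ℕ) :
    c r * c s = c s * c r := by
  rw [hrel, hrel, Nat.choose_symm_add, add_comm r s]

theorem pow_eq_factorial_smul (hp : p.Prime) (h0 : c 0 = 1)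
    (hrel : ∀ r s : ℕ, c r * c s = (((r + s).choose r : k)) • c (r + s)) (m d : ℕ) :
    c (p ^ m) ^ d = (d.factorial : k) • c (p ^ m * d) := by
  induction d with
  | zero => simp [h0]
  | succ d ih =>
    have := Fact.mk hp
    have h : (((p ^ m * (d + 1)).choose (p ^ m * d) : ℕ) : k) = ((d + 1 : ℕ) : k) := by
      rw [CharP.natCast_eq_natCast k p]
      simpa using Choose.choose_pow_mul_pow_mul_modEq_choose_nat (p := p) (k := m)
        (a := d + 1) (b := d)
    rw [pow_succ, ih, smul_mul_assoc, hrel, ← mul_add_one, h, smul_smul, ← Nat.cast_mul,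
      Nat.factorial_succ, mul_comm (d + 1)]

theorem prod_factorial_smul_eq_prod_pow (hp : p.Prime) (h0 : c 0 = 1)
    (hrel : ∀ r s : ℕ, c r * c s = (((r + s).choose r : k)) • c (r + s)) (r m : ℕ) :
    ((((List.range m).map fun i => (pDigit p r i).factorial).prod : ℕ) : k) • c (r % p ^ m) =
      ((List.range m).map fun i => c (p ^ i) ^ pDigit p r i).prod := by
  induction m with
  | zero => simp [h0, Nat.mod_one]
  | succ m ih =>
    have h : (((r % p ^ m + p ^ m * pDigit p r m).choose (r % p ^ m) : ℕ) : k) = 1 := by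
      have := (CharP.intCast_eq_intCast k p).2
        (choose_add_pow_mul_modEq_one hp (Nat.mod_lt r (pow_pos hp.pos m)) (pDigit p r m))
      exact_mod_cast this
    rw [List.prod_range_succ, List.prod_range_succ, ← ih, pow_eq_factorial_smul hp h0 hrel,
      smul_mul_smul_comm, hrel, h, one_smul, Nat.mod_pow_succ, Nat.cast_mul, pDigit]

end DividedPowers

/-- If a finitely supported family `c` of `n × n` matrices over a field of characteristic
`p` (prime) defines a polynomial representation of `G_a` (i.e. `c_0 = 1` and the fundamental
relation holds), then the matrices `N_i := c_(p^i)` pairwise commute, satisfy `N_i^p = 0`,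
and `c_r = Γ_p(r)⁻¹ • ∏ i, N_i ^ (r_i)` where `r = ∑ i, r_i p^i` in base `p`. -/
theorem stmt10 (k : Type*) [Field k] (p : ℕ) (hp : p.Prime) [CharP k p] (n : ℕ)
    (c : ℕ → Matrix (Fin n) (Fin n) k) (hc : (Function.support c).Finite)
    (h0 : c 0 = 1)
    (hrel : ∀ r s : ℕ, c r * c s = (((r + s).choose r : k)) • c (r + s)) :
    (∀ i j : ℕ, c (p ^ i) * c (p ^ j) = c (p ^ j) * c (p ^ i)) ∧
    (∀ i : ℕ, c (p ^ i) ^ p = 0) ∧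
    (∀ r : ℕ, c r = ((gammaP p r : k))⁻¹ • digitPow p (fun i => c (p ^ i)) r) := by
  refine ⟨fun i j => commute_of_mul_eq_choose_smul hrel _ _, fun i => ?_, fun r => ?_⟩
  · rw [pow_eq_factorial_smul hp h0 hrel,
      (CharP.cast_eq_zero_iff k p _).2 (Nat.dvd_factorial hp.pos le_rfl), zero_smul]
  · have h := prod_factorial_smul_eq_prod_pow hp h0 hrel r (r + 1)
    rw [Nat.mod_eq_of_lt (r.lt_succ_self.trans (Nat.lt_pow_self hp.one_lt))] at h
    rw [eq_inv_smul_iff₀ (natCast_gammaP_ne_zero k hp r)]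
    exact h
end

section
/- Let k be a field of characteristic p > 0 with p prime, n ∈ ℕ, and N : ℕ → Matrix (Fin n) (Fin n) k a finitely supported family of pairwise commuting matrices with N_i^p = 0 for all i. Define, for each r ∈ ℕ with base-p expansion r = Σ_i r_i p^i, the matrix c_r := ((Γ_p(r) : k))⁻¹ • ∏_i N_i^{r_i} (finite product over the digits, in order of increasing i). Then c is finitely supported, c_0 = 1, and c_r * c_s = ((r+s).choose r : k) • c_{r+s} for all r, s ∈ ℕ; that is, any finite collection of pairwise commuting p-nilpotent matrices defines an n-dimensional polynomial representation of the additive group G_a over k by this formula. -/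
theorem pDigit_zero_right (p r : ℕ) : pDigit p r 0 = r % p := by
  simp [pDigit]

theorem pDigit_succ (p r i : ℕ) : pDigit p r (i + 1) = pDigit p (r / p) i := by
  rw [pDigit, pDigit, pow_succ', Nat.div_div_eq_div_mul]

theorem pDigit_eq_zero {p r i : ℕ} (h : r < p ^ i) : pDigit p r i = 0 := by
  simp [pDigit, Nat.div_eq_of_lt h]

section Recursion

variable {M : Type*} [Monoid M] {p : ℕ} (f : ℕ → ℕ → M)

theorem prod_pDigit_eq_of_lt (hp : 1 < p) (hf : ∀ i, f i 0 = 1) {r m : ℕ} (hm : r + 1 ≤ m) :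
    ((List.range m).map fun i => f i (pDigit p r i)).prod =
      ((List.range (r + 1)).map fun i => f i (pDigit p r i)).prod := by
  induction m, hm using Nat.le_induction with
  | base => rfl
  | succ m hm ih =>
    have h : pDigit p r m = 0 :=
      pDigit_eq_zero ((Nat.lt_of_succ_le hm).trans (Nat.lt_pow_self hp))
    rw [List.prod_range_succ, ih, h, hf, mul_one]

theorem prod_pDigit_eq_mul (hp : 1 < p) (hf : ∀ i, f i 0 = 1) (r : ℕ) :
    ((List.range (r + 1)).map fun i => f i (pDigit p r i)).prod =
      f 0 (r % p) *
        ((List.range (r / p + 1)).map fun i => f (i + 1) (pDigit p (r / p) i)).prod := by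
  have hle : r / p + 1 ≤ r + 1 := Nat.succ_le_succ (Nat.div_le_self r p)
  rw [← prod_pDigit_eq_of_lt f hp hf (Nat.le_succ (r + 1)), List.prod_range_succ',
    pDigit_zero_right,
    ← prod_pDigit_eq_of_lt (fun i => f (i + 1)) hp (fun i => hf (i + 1)) hle]
  simp only [pDigit_succ]

theorem digitPow_eq_mul (hp : 1 < p) (N : ℕ → M) (r : ℕ) :
    digitPow p N r = N 0 ^ (r % p) * digitPow p (fun i => N (i + 1)) (r / p) :=
  prod_pDigit_eq_mul (fun i d => N i ^ d) hp (fun i => pow_zero (N i)) r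

theorem gammaP_eq_mul (hp : 1 < p) (r : ℕ) :
    gammaP p r = (r % p).factorial * gammaP p (r / p) :=
  prod_pDigit_eq_mul (fun _ d => d.factorial) hp (fun _ => rfl) r

theorem gammaP_zero_right (p : ℕ) : gammaP p 0 = 1 := by
  simp [gammaP, pDigit]

theorem digitPow_zero_right (p : ℕ) (N : ℕ → M) : digitPow p N 0 = 1 := by
  simp [digitPow, pDigit]

theorem Commute.digitPow_right {x : M} {N : ℕ → M} (h : ∀ i, Commute x (N i)) (r : ℕ) :
    Commute x (digitPow p N r) := by
  refine Commute.list_prod_right _ _ fun y hy => ?_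
  obtain ⟨i, -, rfl⟩ := List.mem_map.1 hy
  exact (h i).pow_right _

end Recursion

theorem digitPow_eq_zero_of_pow_le {R : Type*} [MonoidWithZero R] {p B r : ℕ} (hp : 1 < p)
    {N : ℕ → R} (hN : ∀ i, B ≤ i → N i = 0) (hr : p ^ B ≤ r) : digitPow p N r = 0 := by
  have hr0 : r ≠ 0 := (Nat.lt_of_lt_of_le (pow_pos (by lia) B) hr).ne'
  refine List.prod_eq_zero (List.mem_map.2 ⟨Nat.log p r, ?_, ?_⟩)
  · exact List.mem_range.2 (Nat.lt_succ_of_le (Nat.log_le_self p r))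
  · have hlt : r / p ^ Nat.log p r < p := by
      rw [Nat.div_lt_iff_lt_mul (pow_pos (by lia) _), ← pow_succ']
      exact Nat.lt_pow_succ_log_self hp r
    have hpos : 0 < r / p ^ Nat.log p r :=
      Nat.div_pos (Nat.pow_log_le_self p hr0) (pow_pos (by lia) _)
    rw [hN _ (Nat.le_log_of_pow_le hp hr), pDigit, Nat.mod_eq_of_lt hlt, zero_pow hpos.ne']

theorem cast_choose_eq_mod_mul_div (k : Type*) [CommRing k] {p : ℕ} (hp : p.Prime) [CharP k p]
    (m r : ℕ) :
    (m.choose r : k) = ((m % p).choose (r % p) : k) * ((m / p).choose (r / p) : k) := by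
  have : Fact p.Prime := ⟨hp⟩
  rw [← Nat.cast_mul, CharP.natCast_eq_natCast k p]
  exact Choose.choose_modEq_choose_mod_mul_choose_div_nat

theorem inv_factorial_mul_inv_factorial {k : Type*} [Field k] {p : ℕ} (hp : p.Prime) [CharP k p]
    {a b : ℕ} (h : a + b < p) :
    ((a.factorial : k))⁻¹ * ((b.factorial : k))⁻¹ =
      ((a + b).choose a : k) * (((a + b).factorial : k))⁻¹ := by
  have hne : ∀ d, d < p → (d.factorial : k) ≠ 0 := fun d hd h0 =>
    absurd ((hp.dvd_factorial).1 ((CharP.cast_eq_zero_iff k p _).1 h0)) (by lia)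
  have ha := hne a (by lia)
  have hb := hne b (by lia)
  have hab := hne (a + b) h
  have hchoose : ((a + b).choose a : k) * a.factorial * b.factorial = (a + b).factorial := by
    rw [add_comm a b, ← Nat.add_choose_mul_factorial_mul_factorial b a]
    push_cast
    ring
  field_simp
  rw [← hchoose]
  ring

section DividedPower

variable {k A : Type*} [Field k] [Ring A] [Algebra k A] {p : ℕ}

theorem inv_gammaP_smul_digitPow_eq_mul (hp : 1 < p) (N : ℕ → A) (r : ℕ) :
    ((gammaP p r : k))⁻¹ • digitPow p N r =
      ((((r % p).factorial : k))⁻¹ • N 0 ^ (r % p)) *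
        (((gammaP p (r / p) : k))⁻¹ • digitPow p (fun i => N (i + 1)) (r / p)) := by
  rw [gammaP_eq_mul hp, digitPow_eq_mul hp, smul_mul_smul_comm, Nat.cast_mul, mul_inv]

theorem inv_factorial_smul_pow_mul [CharP k p] (hp : p.Prime) {x : A} (hx : x ^ p = 0)
    {a b : ℕ} (ha : a < p) (hb : b < p) :
    (((a.factorial : k))⁻¹ • x ^ a) * (((b.factorial : k))⁻¹ • x ^ b) =
      (((a + b) % p).choose a : k) • ((((a + b) % p).factorial : k))⁻¹ • x ^ ((a + b) % p) := by
  rw [smul_mul_smul_comm, ← pow_add]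
  rcases lt_or_ge (a + b) p with h | h
  · rw [Nat.mod_eq_of_lt h, inv_factorial_mul_inv_factorial hp h, mul_smul]
  · have hmod : (a + b) % p < a := by
      rw [Nat.mod_eq_sub_mod h, Nat.mod_eq_of_lt (by lia)]
      lia
    rw [Nat.choose_eq_zero_of_lt hmod, pow_eq_zero_of_le h hx]
    simp

theorem inv_gammaP_smul_digitPow_mul [CharP k p] (hp : p.Prime) {N : ℕ → A}
    (hcomm : ∀ i j, Commute (N i) (N j)) (hnil : ∀ i, N i ^ p = 0) (r s : ℕ) :
    (((gammaP p r : k))⁻¹ • digitPow p N r) * (((gammaP p s : k))⁻¹ • digitPow p N s) =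
      ((r + s).choose r : k) • (((gammaP p (r + s) : k))⁻¹ • digitPow p N (r + s)) := by
  induction r using Nat.strong_induction_on generalizing N s with
  | _ r ih =>
  rcases Nat.eq_zero_or_pos r with rfl | hr
  · simp [gammaP_zero_right, digitPow_zero_right]
  have hp1 := hp.one_lt
  have hc : Commute
      (((gammaP p (r / p) : k))⁻¹ • digitPow p (fun i => N (i + 1)) (r / p))
      ((((s % p).factorial : k))⁻¹ • N 0 ^ (s % p)) :=
    (((Commute.digitPow_right (fun i => hcomm 0 (i + 1)) (r / p)).pow_left
      (s % p)).symm.smul_left _).smul_right _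
  rw [inv_gammaP_smul_digitPow_eq_mul hp1 N r, inv_gammaP_smul_digitPow_eq_mul hp1 N s,
    inv_gammaP_smul_digitPow_eq_mul hp1 N (r + s), hc.mul_mul_mul_comm,
    inv_factorial_smul_pow_mul hp (hnil 0) (Nat.mod_lt r hp.pos) (Nat.mod_lt s hp.pos),
    ih (r / p) (Nat.div_lt_self hr hp1) (fun i j => hcomm (i + 1) (j + 1))
      (fun i => hnil (i + 1)) (s / p),
    cast_choose_eq_mod_mul_div k hp (r + s) r, ← Nat.add_mod]
  rcases lt_or_ge (r % p + s % p) p with h | h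
  · rw [Nat.add_div hp.pos, if_neg (not_le.2 h), add_zero, smul_mul_smul_comm]
  · have hmod : (r + s) % p < r % p := by
      have := Nat.mod_lt s hp.pos
      have := Nat.mod_lt r hp.pos
      rw [Nat.add_mod, Nat.mod_eq_sub_mod h, Nat.mod_eq_of_lt (by lia)]
      lia
    simp [Nat.choose_eq_zero_of_lt hmod]

end DividedPower

/-- Over a field of characteristic `p` (prime), any finitely supported family of pairwise
commuting `p`-nilpotent `n × n` matrices `N_i` defines an `n`-dimensional polynomial
representation of `G_a` by `c_r := Γ_p(r)⁻¹ • ∏ i, N_i ^ (r_i)` (digits of `r` in base `p`):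
the family `c` is finitely supported, `c_0 = 1`, and the fundamental relation
`c_r * c_s = (r+s choose r) • c_(r+s)` holds. -/
theorem stmt11 (k : Type*) [Field k] (p : ℕ) (hp : p.Prime) [CharP k p] (n : ℕ)
    (N : ℕ → Matrix (Fin n) (Fin n) k) (hN : (Function.support N).Finite)
    (hcomm : ∀ i j : ℕ, N i * N j = N j * N i) (hnil : ∀ i : ℕ, N i ^ p = 0) :
    (Function.support fun r : ℕ => ((gammaP p r : k))⁻¹ • digitPow p N r).Finite ∧
    ((gammaP p 0 : k))⁻¹ • digitPow p N 0 = 1 ∧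
    (∀ r s : ℕ,
      (((gammaP p r : k))⁻¹ • digitPow p N r) * (((gammaP p s : k))⁻¹ • digitPow p N s) =
        (((r + s).choose r : k)) •
          (((gammaP p (r + s) : k))⁻¹ • digitPow p N (r + s))) := by
  refine ⟨?_, ?_, inv_gammaP_smul_digitPow_mul hp hcomm hnil⟩
  · obtain ⟨B, hB⟩ := hN.bddAbove
    have hzero : ∀ i, B + 1 ≤ i → N i = 0 := fun i hi => by
      by_contra h
      exact absurd (hB h) (by lia)
    refine (Set.finite_lt_nat (p ^ (B + 1))).subset fun r hr => ?_
    by_contra hle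
    exact hr (by simp [digitPow_eq_zero_of_pow_le hp.one_lt hzero (not_lt.1 hle)])
  · simp [gammaP_zero_right, digitPow_zero_right]
end

section
/- Let R be an associative unital ring (not necessarily commutative), let X, Y ∈ R, set Z := X*Y − Y*X, and assume X*Z = Z*X and Y*Z = Z*Y. Then for all n, m ∈ ℕ: X^n * Y^m = Σ_{l=0}^{min(n,m)} ( l! · (n.choose l) · (m.choose l) ) • ( Z^l * Y^{m−l} * X^{n−l} ), where • denotes the natural-number scalar action (iterated addition) on R. -/
theorem mul_pow_eq_of_commutator_central {R : Type*} [Ring R] {X Y Z : R}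
    (hZ : Z = X * Y - Y * X) (hYZ : Y * Z = Z * Y) (k : ℕ) :
    X * Y ^ k = Y ^ k * X + k • (Z * Y ^ (k - 1)) := by
  have hXY : X * Y = Y * X + Z := by rw [hZ]; abel
  induction k with
  | zero => simp
  | succ k ih =>
    have h : k • (Z * Y ^ (k - 1)) * Y = k • (Z * Y ^ k) := by
      cases k with
      | zero => simp
      | succ j => rw [smul_mul_assoc, mul_assoc, Nat.add_sub_cancel, ← pow_succ]
    have hc : Y ^ k * Z = Z * Y ^ k := Commute.pow_left hYZ k
    rw [pow_succ, ← mul_assoc, ih, add_mul, h, mul_assoc, hXY, mul_add, ← mul_assoc, hc,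
      Nat.add_sub_cancel, succ_nsmul]
    abel

theorem pow_mul_pow_eq_sum_range_of_commutator_central {R : Type*} [Ring R] {X Y Z : R}
    (hZ : Z = X * Y - Y * X) (hXZ : X * Z = Z * X) (hYZ : Y * Z = Z * Y) (n m : ℕ) :
    X ^ n * Y ^ m = ∑ l ∈ Finset.range (n + 1),
      (l.factorial * n.choose l * m.choose l) • (Z ^ l * Y ^ (m - l) * X ^ (n - l)) := by
  induction n with
  | zero => simp
  | succ n ih =>
    have hterm : ∀ l ∈ Finset.range (n + 1),
        X * ((l.factorial * n.choose l * m.choose l) • (Z ^ l * Y ^ (m - l) * X ^ (n - l))) =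
          (l.factorial * n.choose l * m.choose l) • (Z ^ l * Y ^ (m - l) * X ^ (n + 1 - l)) +
          ((l + 1).factorial * n.choose l * m.choose (l + 1)) •
            (Z ^ (l + 1) * Y ^ (m - (l + 1)) * X ^ (n - l)) := by
      intro l hl
      have hln : l ≤ n := Nat.lt_succ_iff.mp (Finset.mem_range.mp hl)
      have hc : X * Z ^ l = Z ^ l * X := Commute.pow_right hXZ l
      have hcoeff : (l + 1).factorial * n.choose l * m.choose (l + 1) =
          l.factorial * n.choose l * m.choose l * (m - l) := by
        have := Nat.choose_succ_right_eq m l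
        rw [Nat.factorial_succ]
        linear_combination (l.factorial * n.choose l) * this
      have hmul : X * (Z ^ l * Y ^ (m - l) * X ^ (n - l)) =
          Z ^ l * Y ^ (m - l) * X ^ (n + 1 - l) +
            (m - l) • (Z ^ (l + 1) * Y ^ (m - (l + 1)) * X ^ (n - l)) := by
        rw [← mul_assoc, ← mul_assoc, hc, mul_assoc (Z ^ l) X,
          mul_pow_eq_of_commutator_central hZ hYZ, Nat.succ_sub hln, pow_succ' X, pow_succ Z,
          Nat.sub_sub]
        simp only [mul_add, add_mul, mul_smul_comm, smul_mul_assoc, mul_assoc]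
      rw [mul_smul_comm, hmul, smul_add, smul_smul, hcoeff]
    rw [pow_succ', mul_assoc, ih, Finset.mul_sum, Finset.sum_congr rfl hterm,
      Finset.sum_add_distrib, Finset.sum_range_succ' _ (n + 1)]
    have hext : ∑ l ∈ Finset.range (n + 1), (l.factorial * n.choose l * m.choose l) •
          (Z ^ l * Y ^ (m - l) * X ^ (n + 1 - l)) =
        ∑ l ∈ Finset.range (n + 1 + 1), (l.factorial * n.choose l * m.choose l) •
          (Z ^ l * Y ^ (m - l) * X ^ (n + 1 - l)) := by
      rw [Finset.sum_range_succ _ (n + 1)]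
      simp
    rw [hext, Finset.sum_range_succ' _ (n + 1), add_right_comm, ← Finset.sum_add_distrib]
    congr 1
    · refine Finset.sum_congr rfl fun l _ => ?_
      rw [Nat.add_sub_add_right, ← add_smul, Nat.choose_succ_succ' n l]
      congr 1
      ring
    · simp

/-- In any associative unital ring, if `Z = X*Y - Y*X` commutes with both `X` and `Y`, then
`X^n * Y^m = ∑_{l=0}^{min n m} (l! * (n choose l) * (m choose l)) • (Z^l * Y^(m-l) * X^(n-l))`. -/
theorem stmt12 (R : Type*) [Ring R] (X Y Z : R) (hZ : Z = X * Y - Y * X)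
    (hXZ : X * Z = Z * X) (hYZ : Y * Z = Z * Y) (n m : ℕ) :
    X ^ n * Y ^ m = ∑ l ∈ Finset.range (min n m + 1),
      (l.factorial * n.choose l * m.choose l) • (Z ^ l * Y ^ (m - l) * X ^ (n - l)) := by
  rw [pow_mul_pow_eq_sum_range_of_commutator_central hZ hXZ hYZ]
  symm
  refine Finset.sum_subset (Finset.range_subset_range.mpr (by omega)) fun l hl hl' => ?_
  rw [Finset.mem_range] at hl hl'
  rw [Nat.choose_eq_zero_of_lt (show m < l by omega), mul_zero, zero_smul]
end

section
/- Let k be a field, d ∈ ℕ, and c : ℕ × ℕ × ℕ → Matrix (Fin d) (Fin d) k a finitely supported family. For elements x, y, z of a commutative k-algebra write M(x,y,z) := Σ_{(n,m,l)} (x^n y^m z^l) • c_{(n,m,l)} (a finite sum). Then the identity M(x,y,z) * M(x',y',z') = M(x+x', y+y', z+z'+x*y') holds in Matrix (Fin d) (Fin d) (MvPolynomial (Fin 6) k), where x, y, z, x', y', z' are the six polynomial variables, if and only if c satisfies the Heisenberg fundamental relation: for all triples r = (r₁,r₂,r₃) and s = (s₁,s₂,s₃) of natural numbers, c_r * c_s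 = Σ_{l=0}^{min(r₁,s₂)} ( (r₁+s₁−l).choose s₁ · (r₂+s₂−l).choose r₂ · ((r₃+s₃+l)! / (r₃!·s₃!·l!)) : k ) • c_{(r₁+s₁−l, r₂+s₂−l, r₃+s₃+l)}. Consequently c defines a d-dimensional polynomial representation of the Heisenberg group H₁ (whose group law is (x,y,z)·(x',y',z') = (x+x', y+y', z+z'+x·y')) if and only if moreover c_{(0,0,0)} = 1. -/
/-- The matrix `M(x,y,z) = ∑_{(n,m,l)}, (x^n y^m z^l) • c_(n,m,l)`. -/
noncomputable def heisM (k : Type*) [Field k] (d : ℕ)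
    (c : ℕ × ℕ × ℕ → Matrix (Fin d) (Fin d) k)
    (x y z : MvPolynomial (Fin 6) k) : Matrix (Fin d) (Fin d) (MvPolynomial (Fin 6) k) :=
  ∑ᶠ r : ℕ × ℕ × ℕ, (x ^ r.1 * y ^ r.2.1 * z ^ r.2.2) •
    (c r).map (MvPolynomial.C : k →+* MvPolynomial (Fin 6) k)

/-- The Heisenberg fundamental relation for a family of matrices. -/
def HeisRel (k : Type*) [Field k] (d : ℕ)
    (c : ℕ × ℕ × ℕ → Matrix (Fin d) (Fin d) k) : Prop :=
  ∀ r s : ℕ × ℕ × ℕ,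
    c r * c s = ∑ l ∈ Finset.range (min r.1 s.2.1 + 1),
      ((((r.1 + s.1 - l).choose s.1) * ((r.2.1 + s.2.1 - l).choose r.2.1) *
        ((r.2.2 + s.2.2 + l).factorial /
          (r.2.2.factorial * s.2.2.factorial * l.factorial)) : ℕ) : k) •
      c (r.1 + s.1 - l, r.2.1 + s.2.1 - l, r.2.2 + s.2.2 + l)

open MvPolynomial in
theorem heisM_apply {k : Type*} [Field k] {d : ℕ} {c : ℕ × ℕ × ℕ → Matrix (Fin d) (Fin d) k}
    {S : Finset (ℕ × ℕ × ℕ)} (hS : Function.support c ⊆ S) (x y z : MvPolynomial (Fin 6) k)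
    (i j : Fin d) :
    heisM k d c x y z i j = ∑ t ∈ S, C (c t i j) * (x ^ t.1 * y ^ t.2.1 * z ^ t.2.2) := by
  rw [heisM, finsum_eq_sum_of_support_subset (s := S)]
  · simp [Matrix.sum_apply, mul_comm]
  · refine subset_trans (Function.support_subset_iff'.2 fun t ht => ?_) hS
    rw [Function.notMem_support] at ht
    ext
    simp [ht]

/-- The exponent of the monomial `x^r₁ y^r₂ z^r₃ x'^s₁ y'^s₂ z'^s₃`. -/
noncomputable def heisExp (r s : ℕ × ℕ × ℕ) : Fin 6 →₀ ℕ :=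
  Finsupp.equivFunOnFinite.symm ![r.1, r.2.1, r.2.2, s.1, s.2.1, s.2.2]

theorem heisExp_inj {r s r' s' : ℕ × ℕ × ℕ} :
    heisExp r s = heisExp r' s' ↔ r = r' ∧ s = s' := by
  obtain ⟨r1, r2, r3⟩ := r
  obtain ⟨s1, s2, s3⟩ := s
  obtain ⟨r1', r2', r3'⟩ := r'
  obtain ⟨s1', s2', s3'⟩ := s'
  simp only [heisExp, EmbeddingLike.apply_eq_iff_eq, Matrix.vecCons_inj, Prod.mk.injEq]
  tauto

theorem exists_heisExp_eq (m : Fin 6 →₀ ℕ) : ∃ r s, heisExp r s = m := by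
  refine ⟨(m 0, m 1, m 2), (m 3, m 4, m 5), ?_⟩
  ext a
  fin_cases a <;> rfl

open MvPolynomial in
theorem monomial_heisExp {k : Type*} [Field k] (r s : ℕ × ℕ × ℕ) :
    monomial (heisExp r s) (1 : k) =
      X 0 ^ r.1 * X 1 ^ r.2.1 * X 2 ^ r.2.2 * (X 3 ^ s.1 * X 4 ^ s.2.1 * X 5 ^ s.2.2) := by
  rw [monomial_eq, Finsupp.prod_fintype _ _ (by simp), Fin.prod_univ_six]
  simp [heisExp, mul_assoc]

open MvPolynomial in
theorem coeff_heisM_mul {k : Type*} [Field k] {d : ℕ} {c : ℕ × ℕ × ℕ → Matrix (Fin d) (Fin d) k}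
    (hc : (Function.support c).Finite) (r s : ℕ × ℕ × ℕ) (i j : Fin d) :
    coeff (heisExp r s) ((heisM k d c (X 0) (X 1) (X 2) * heisM k d c (X 3) (X 4) (X 5)) i j) =
      (c r * c s) i j := by
  have hS : Function.support c ⊆ hc.toFinset := by simp
  have h0 (t) (ht : t ∉ hc.toFinset) : c t = 0 := by simpa using ht
  have key : (heisM k d c (X 0) (X 1) (X 2) * heisM k d c (X 3) (X 4) (X 5)) i j =
      ∑ a ∈ hc.toFinset, ∑ b ∈ hc.toFinset,
        C ((c a * c b) i j) * monomial (heisExp a b) 1 := by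
    simp only [Matrix.mul_apply, heisM_apply hS, Finset.sum_mul_sum]
    simp only [map_sum, Finset.sum_mul, monomial_heisExp, map_mul]
    rw [Finset.sum_comm]
    refine Finset.sum_congr rfl fun a _ => ?_
    rw [Finset.sum_comm]
    refine Finset.sum_congr rfl fun b _ => Finset.sum_congr rfl fun e _ => ?_
    ring
  simp only [key, coeff_sum, coeff_C_mul, coeff_monomial, heisExp_inj]
  rw [Finset.sum_eq_single r, Finset.sum_eq_single s]
  · simp
  · intro b _ hb
    simp [hb]
  · intro h
    simp [h0 s h]
  · intro a _ ha
    simp [ha]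
  · intro h
    simp [h0 r h]

theorem choose_mul_choose_eq_factorial_div (a b l : ℕ) :
    (a + b + l).choose l * (a + b).choose a =
      (a + b + l).factorial / (a.factorial * b.factorial * l.factorial) := by
  refine (Nat.div_eq_of_eq_mul_left (by positivity) ?_).symm
  rw [← Nat.add_choose_mul_factorial_mul_factorial (a + b) l,
    ← Nat.add_choose_mul_factorial_mul_factorial a b, Nat.choose_symm_add]
  ring

open MvPolynomial in
theorem heis_product_expansion {k : Type*} [Field k] (n m p : ℕ) :
    ((X 0 + X 3) ^ n * (X 1 + X 4) ^ m * (X 2 + X 5 + X 0 * X 4) ^ p :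
        MvPolynomial (Fin 6) k) =
      ∑ u ∈ Finset.HasAntidiagonal.antidiagonal n, ∑ v ∈ Finset.HasAntidiagonal.antidiagonal m, ∑ w ∈ Finset.HasAntidiagonal.antidiagonal p,
        ∑ q ∈ Finset.HasAntidiagonal.antidiagonal w.1,
          monomial (heisExp (u.1 + w.2, v.1, q.1) (u.2, v.2 + w.2, q.2))
            ((n.choose u.2 * m.choose v.1 * (p.choose w.2 * w.1.choose q.1) : ℕ) : k) := by
  have hm (r s) (a : k) : monomial (heisExp r s) a = monomial (heisExp r s) 1 * C a := by
    rw [mul_comm, C_mul_monomial, mul_one]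
  have hp (a b : MvPolynomial (Fin 6) k) (n : ℕ) := (Commute.all a b).add_pow' n
  simp only [hp]
  rw [Finset.sum_mul_sum]
  simp only [Finset.sum_mul]
  simp only [Finset.mul_sum, Finset.smul_sum]
  refine Finset.sum_congr rfl fun u hu => Finset.sum_congr rfl fun v _ =>
    Finset.sum_congr rfl fun w hw => Finset.sum_congr rfl fun q _ => ?_
  rw [Finset.HasAntidiagonal.mem_antidiagonal] at hu hw
  rw [hm, monomial_heisExp, ← Nat.choose_symm_of_eq_add hu.symm,
    ← Nat.choose_symm_of_eq_add hw.symm]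
  simp only [nsmul_eq_mul, Nat.cast_mul, map_mul, map_natCast]
  ring

open MvPolynomial in
theorem coeff_heis_product {k : Type*} [Field k] (r s t : ℕ × ℕ × ℕ) :
    coeff (heisExp r s) ((X 0 + X 3) ^ t.1 * (X 1 + X 4) ^ t.2.1 *
        (X 2 + X 5 + X 0 * X 4) ^ t.2.2 : MvPolynomial (Fin 6) k) =
      ∑ l ∈ Finset.range (min r.1 s.2.1 + 1),
        if t = (r.1 + s.1 - l, r.2.1 + s.2.1 - l, r.2.2 + s.2.2 + l) then
          ((((r.1 + s.1 - l).choose s.1) * ((r.2.1 + s.2.1 - l).choose r.2.1) *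
            ((r.2.2 + s.2.2 + l).factorial /
              (r.2.2.factorial * s.2.2.factorial * l.factorial)) : ℕ) : k)
        else 0 := by
  obtain ⟨r1, r2, r3⟩ := r
  obtain ⟨s1, s2, s3⟩ := s
  obtain ⟨n, m, p⟩ := t
  simp only [heis_product_expansion, coeff_sum, coeff_monomial, heisExp_inj, Prod.mk.injEq]
  by_cases h : ∃ l, l ≤ r1 ∧ l ≤ s2 ∧ n + l = r1 + s1 ∧ m + l = r2 + s2 ∧ p = r3 + s3 + l
  · obtain ⟨l, h1, h2, hn, hm, rfl⟩ := h
    obtain ⟨a, rfl⟩ := Nat.exists_eq_add_of_le' h1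
    obtain ⟨b, rfl⟩ := Nat.exists_eq_add_of_le' h2
    obtain rfl : n = a + s1 := by lia
    obtain rfl : m = r2 + b := by lia
    rw [Finset.sum_eq_single (a, s1), Finset.sum_eq_single (r2, b),
      Finset.sum_eq_single (r3 + s3, l), Finset.sum_eq_single (r3, s3), Finset.sum_eq_single l,
      if_pos (by simp), if_pos (by lia), choose_mul_choose_eq_factorial_div,
      show a + l + s1 - l = a + s1 by lia, show r2 + (b + l) - l = r2 + b by lia]
    all_goals
      simp only [Finset.HasAntidiagonal.mem_antidiagonal, Finset.mem_range, Prod.forall, ne_eq, Prod.mk.injEq]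
    · intros
      rw [if_neg (by lia)]
    · intros
      lia
    · intros
      rw [if_neg (by lia)]
    · intros
      lia
    · intros
      refine Finset.sum_eq_zero fun q hq => if_neg ?_
      rw [Finset.HasAntidiagonal.mem_antidiagonal] at hq
      lia
    · intros
      lia
    · intros
      refine Finset.sum_eq_zero fun w hw => Finset.sum_eq_zero fun q hq => if_neg ?_
      rw [Finset.HasAntidiagonal.mem_antidiagonal] at hw hq
      lia
    · intros
      lia
    · intros
      refine Finset.sum_eq_zero fun v hv => Finset.sum_eq_zero fun w hw =>
        Finset.sum_eq_zero fun q hq => if_neg ?_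
      rw [Finset.HasAntidiagonal.mem_antidiagonal] at hv hw hq
      lia
    · intros
      lia
  · trans 0
    · refine Finset.sum_eq_zero fun u hu => Finset.sum_eq_zero fun v hv =>
        Finset.sum_eq_zero fun w hw => Finset.sum_eq_zero fun q hq => if_neg fun e => h ?_
      rw [Finset.HasAntidiagonal.mem_antidiagonal] at hu hv hw hq
      exact ⟨w.2, by lia⟩
    · refine (Finset.sum_eq_zero fun l hl => if_neg fun e => h ?_).symm
      rw [Finset.mem_range] at hl
      exact ⟨l, by lia⟩

open MvPolynomial in
theorem coeff_heisM_group_law {k : Type*} [Field k] {d : ℕ}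
    {c : ℕ × ℕ × ℕ → Matrix (Fin d) (Fin d) k} (hc : (Function.support c).Finite)
    (r s : ℕ × ℕ × ℕ) (i j : Fin d) :
    coeff (heisExp r s)
        (heisM k d c (X 0 + X 3) (X 1 + X 4) (X 2 + X 5 + X 0 * X 4) i j) =
      (∑ l ∈ Finset.range (min r.1 s.2.1 + 1),
        ((((r.1 + s.1 - l).choose s.1) * ((r.2.1 + s.2.1 - l).choose r.2.1) *
          ((r.2.2 + s.2.2 + l).factorial /
            (r.2.2.factorial * s.2.2.factorial * l.factorial)) : ℕ) : k) •
        c (r.1 + s.1 - l, r.2.1 + s.2.1 - l, r.2.2 + s.2.2 + l)) i j := by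
  have hS : Function.support c ⊆ hc.toFinset := by simp
  have h0 (t) (ht : t ∉ hc.toFinset) : c t = 0 := by simpa using ht
  simp only [heisM_apply hS, coeff_sum, coeff_C_mul, coeff_heis_product, Finset.mul_sum,
    Matrix.sum_apply, Matrix.smul_apply, smul_eq_mul]
  rw [Finset.sum_comm]
  refine Finset.sum_congr rfl fun l _ => ?_
  rw [Finset.sum_eq_single (r.1 + s.1 - l, r.2.1 + s.2.1 - l, r.2.2 + s.2.2 + l)]
  · rw [if_pos rfl, mul_comm]
  · intro t _ ht
    rw [if_neg ht, mul_zero]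
  · intro h
    simp [h0 _ h]

open MvPolynomial in
theorem heisM_mul_eq_iff_heisRel {k : Type*} [Field k] {d : ℕ}
    {c : ℕ × ℕ × ℕ → Matrix (Fin d) (Fin d) k} (hc : (Function.support c).Finite) :
    heisM k d c (X 0) (X 1) (X 2) * heisM k d c (X 3) (X 4) (X 5) =
      heisM k d c (X 0 + X 3) (X 1 + X 4) (X 2 + X 5 + X 0 * X 4) ↔ HeisRel k d c := by
  constructor
  · intro h r s
    ext i j
    rw [← coeff_heisM_mul hc, h, coeff_heisM_group_law hc]
  · intro h
    ext i j m
    obtain ⟨r, s, rfl⟩ := exists_heisExp_eq m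
    rw [coeff_heisM_mul hc, h r s, coeff_heisM_group_law hc]

theorem heisM_zero_eq_one_iff {k : Type*} [Field k] {d : ℕ}
    {c : ℕ × ℕ × ℕ → Matrix (Fin d) (Fin d) k} :
    heisM k d c 0 0 0 = 1 ↔ c (0, 0, 0) = 1 := by
  have h : heisM k d c 0 0 0 = (c (0, 0, 0)).map MvPolynomial.C := by
    rw [heisM, finsum_eq_single _ (0, 0, 0)]
    · simp
    · rintro ⟨a, b, e⟩ ht
      have h : a ≠ 0 ∨ b ≠ 0 ∨ e ≠ 0 := by
        simp only [ne_eq, Prod.mk.injEq] at ht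
        tauto
      rcases h with h | h | h <;> simp [h]
  rw [h, ← Matrix.map_one (MvPolynomial.C : k →+* MvPolynomial (Fin 6) k) (map_zero _)
    (map_one _)]
  exact (Matrix.map_injective (MvPolynomial.C_injective _ _)).eq_iff

/-- A finitely supported family `c` of `d × d` matrices satisfies
`M(x,y,z) * M(x',y',z') = M(x+x', y+y', z+z'+x*y')` (in six polynomial variables) if and
only if `c` satisfies the Heisenberg fundamental relation; consequently `c` defines a
`d`-dimensional polynomial representation of the Heisenberg group `H₁` if and only if
moreover `c_(0,0,0) = 1`. -/
theorem stmt13 (k : Type*) [Field k] (d : ℕ)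
    (c : ℕ × ℕ × ℕ → Matrix (Fin d) (Fin d) k) (hc : (Function.support c).Finite) :
    (heisM k d c (MvPolynomial.X 0) (MvPolynomial.X 1) (MvPolynomial.X 2) *
        heisM k d c (MvPolynomial.X 3) (MvPolynomial.X 4) (MvPolynomial.X 5) =
      heisM k d c (MvPolynomial.X 0 + MvPolynomial.X 3) (MvPolynomial.X 1 + MvPolynomial.X 4)
        (MvPolynomial.X 2 + MvPolynomial.X 5 + MvPolynomial.X 0 * MvPolynomial.X 4) ↔
      HeisRel k d c) ∧
    ((heisM k d c 0 0 0 = 1 ∧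
        heisM k d c (MvPolynomial.X 0) (MvPolynomial.X 1) (MvPolynomial.X 2) *
          heisM k d c (MvPolynomial.X 3) (MvPolynomial.X 4) (MvPolynomial.X 5) =
        heisM k d c (MvPolynomial.X 0 + MvPolynomial.X 3) (MvPolynomial.X 1 + MvPolynomial.X 4)
          (MvPolynomial.X 2 + MvPolynomial.X 5 + MvPolynomial.X 0 * MvPolynomial.X 4)) ↔
      (c (0, 0, 0) = 1 ∧ HeisRel k d c)) := by
  exact ⟨heisM_mul_eq_iff_heisRel hc,
    and_congr heisM_zero_eq_one_iff (heisM_mul_eq_iff_heisRel hc)⟩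
end

section
/- Let k be a field of characteristic zero, d ∈ ℕ, and c : ℕ × ℕ × ℕ → Matrix (Fin d) (Fin d) k a finitely supported family with c_{(0,0,0)} = 1. Then c satisfies the Heisenberg fundamental relation (for all triples r = (r₁,r₂,r₃), s = (s₁,s₂,s₃): c_r * c_s = Σ_{l=0}^{min(r₁,s₂)} ( (r₁+s₁−l).choose s₁ · (r₂+s₂−l).choose r₂ · ((r₃+s₃+l)!/(r₃!·s₃!·l!)) : k ) • c_{(r₁+s₁−l, r₂+s₂−l, r₃+s₃+l)}) if and only if there exist nilpotent matrices X, Y ∈ Matrix (Fin d) (Fin d) k such that Z := X*Y − Y*X is nilpotent, X*Z = Z*X, Y*Z = Z*Y, and c_{(n,m,l)} = ((n!·m!·l! : k))⁻¹ • (Y^m * X^n * Z^l) for all n, m, l ∈ ℕ. In that case necessarily X = c_{(1,0,0)}, Y = c_{(0,1,0)} and Z = c_{(0,0,1)}. -/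
/-- Moving `X` to the right past a power of `Y`, when `X * Y = Y * X + Z` and `Z` commutes
with `Y`. -/
theorem mul_pow_of_heisenberg {R : Type*} [Ring R] {X Y Z : R} (hXY : X * Y = Y * X + Z)
    (hY : Commute Y Z) (m : ℕ) :
    X * Y ^ m = Y ^ m * X + m • (Y ^ (m - 1) * Z) := by
  induction m with
  | zero => simp
  | succ m ih =>
    have h1 : m • (Y ^ (m - 1) * Z) * Y = m • (Y ^ m * Z) := by
      rcases m with _ | m
      · simp
      · rw [smul_mul_assoc, mul_assoc, ← hY.eq, ← mul_assoc, Nat.add_sub_cancel, ← pow_succ]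
    rw [pow_succ, ← mul_assoc, ih, add_mul, h1, mul_assoc, hXY, mul_add, ← mul_assoc,
      Nat.add_sub_cancel, succ_nsmul]
    abel

open Finset in
/-- Normal ordering in the Heisenberg algebra. -/
theorem pow_mul_pow_of_heisenberg {R : Type*} [Ring R] {X Y Z : R} (hXY : X * Y = Y * X + Z)
    (hX : Commute X Z) (hY : Commute Y Z) (n m : ℕ) :
    X ^ n * Y ^ m = ∑ l ∈ range (n + 1),
      (m.descFactorial l * n.choose l) • (Y ^ (m - l) * X ^ (n - l) * Z ^ l) := by
  induction n with
  | zero => simp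
  | succ n ih =>
    have step : ∀ l ∈ range (n + 1),
        X * ((m.descFactorial l * n.choose l) • (Y ^ (m - l) * X ^ (n - l) * Z ^ l)) =
          (m.descFactorial l * n.choose l) • (Y ^ (m - l) * X ^ (n + 1 - l) * Z ^ l) +
          (m.descFactorial (l + 1) * n.choose l) •
            (Y ^ (m - (l + 1)) * X ^ (n + 1 - (l + 1)) * Z ^ (l + 1)) := by
      intro l hl
      have hl' : l ≤ n := Nat.lt_succ_iff.mp (mem_range.mp hl)
      have e1 : n + 1 - l = n - l + 1 := by omega
      have e2 : n + 1 - (l + 1) = n - l := by omega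
      have hZ : Z * X ^ (n - l) = X ^ (n - l) * Z := (hX.pow_left _).eq.symm
      rw [mul_smul_comm, ← mul_assoc, ← mul_assoc, mul_pow_of_heisenberg hXY hY, e1, e2,
        add_mul, add_mul, smul_add, Nat.descFactorial_succ, Nat.sub_sub, smul_mul_assoc,
        smul_mul_assoc, smul_smul, mul_assoc (Y ^ (m - l)) X, ← pow_succ',
        mul_assoc _ Z, hZ, mul_assoc _ _ (Z ^ l), mul_assoc _ _ (Z ^ l), mul_assoc _ Z,
        ← pow_succ' Z]
      congr 2
      · ring
      · simp only [mul_assoc]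
    rw [pow_succ', mul_assoc, ih, mul_sum, sum_congr rfl step, sum_add_distrib,
      sum_range_succ' _ (n + 1)]
    have extended : ∑ l ∈ range (n + 1),
        (m.descFactorial l * n.choose l) • (Y ^ (m - l) * X ^ (n + 1 - l) * Z ^ l) =
        ∑ l ∈ range (n + 1 + 1),
        (m.descFactorial l * n.choose l) • (Y ^ (m - l) * X ^ (n + 1 - l) * Z ^ l) := by
      rw [sum_range_succ _ (n + 1)]
      simp
    rw [extended, sum_range_succ' _ (n + 1), add_right_comm, ← sum_add_distrib]
    congr 1
    · refine sum_congr rfl fun l _ => ?_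
      rw [← add_smul, Nat.choose_succ_succ]
      congr 1
      ring
    · simp

/-- The coefficient of the Heisenberg fundamental relation matches that of normal ordering. -/
theorem heisenberg_coeff {k : Type*} [Field k] [CharZero k] {l r₁ s₂ : ℕ} (hr : l ≤ r₁)
    (hs : l ≤ s₂) (r₂ r₃ s₁ s₃ : ℕ) :
    ((r₁.factorial * r₂.factorial * r₃.factorial : ℕ) : k)⁻¹ *
      ((s₁.factorial * s₂.factorial * s₃.factorial : ℕ) : k)⁻¹ *
      ((s₂.descFactorial l * r₁.choose l : ℕ) : k) =
    (((r₁ + s₁ - l).choose s₁ * (r₂ + s₂ - l).choose r₂ *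
      ((r₃ + s₃ + l).factorial / (r₃.factorial * s₃.factorial * l.factorial)) : ℕ) : k) *
      (((r₁ + s₁ - l).factorial * (r₂ + s₂ - l).factorial *
        (r₃ + s₃ + l).factorial : ℕ) : k)⁻¹ := by
  obtain ⟨a, rfl⟩ := Nat.exists_eq_add_of_le hr
  obtain ⟨b, rfl⟩ := Nat.exists_eq_add_of_le hs
  have e1 : l + a + s₁ - l = a + s₁ := by omega
  have e2 : r₂ + (l + b) - l = r₂ + b := by omega
  have hdvd : r₃.factorial * s₃.factorial * l.factorial ∣ (r₃ + s₃ + l).factorial :=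
    (mul_dvd_mul_right (Nat.factorial_mul_factorial_dvd_factorial_add _ _) _).trans
      (Nat.factorial_mul_factorial_dvd_factorial_add _ _)
  have hf : ∀ n : ℕ, (n.factorial : k) ≠ 0 := fun n => by
    exact_mod_cast n.factorial_ne_zero
  have hd : ((l + b).descFactorial l : k) = (l + b).factorial / b.factorial := by
    rw [eq_div_iff (hf b), mul_comm]
    have := Nat.factorial_mul_descFactorial (Nat.le_add_right l b)
    rw [Nat.add_sub_cancel_left] at this
    exact_mod_cast this
  rw [e1, e2, add_comm a s₁]
  simp only [Nat.cast_mul]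
  rw [Nat.cast_div hdvd (by simp [hf]), hd, Nat.cast_add_choose, Nat.cast_add_choose,
    Nat.cast_add_choose]
  simp only [Nat.cast_mul]
  field_simp [hf]

open Finset in
/-- Normalized normally ordered monomials in a Heisenberg triple satisfy the Heisenberg
fundamental relation. -/
theorem HeisRel.of_eq {k : Type*} [Field k] [CharZero k] {d : ℕ}
    {c : ℕ × ℕ × ℕ → Matrix (Fin d) (Fin d) k} {X Y Z : Matrix (Fin d) (Fin d) k}
    (hXY : X * Y = Y * X + Z) (hX : Commute X Z) (hY : Commute Y Z)
    (h : ∀ n m l : ℕ, c (n, m, l) =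
      (((n.factorial * m.factorial * l.factorial : ℕ) : k))⁻¹ • (Y ^ m * X ^ n * Z ^ l)) :
    HeisRel k d c := by
  rintro ⟨r₁, r₂, r₃⟩ ⟨s₁, s₂, s₃⟩
  have order : X ^ r₁ * Y ^ s₂ = ∑ l ∈ range (min r₁ s₂ + 1),
      (s₂.descFactorial l * r₁.choose l) • (Y ^ (s₂ - l) * X ^ (r₁ - l) * Z ^ l) := by
    rw [pow_mul_pow_of_heisenberg hXY hX hY]
    refine (sum_subset (range_subset_range.mpr (by omega)) fun l h1 h2 => ?_).symm
    rw [mem_range] at h1 h2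
    rw [Nat.descFactorial_eq_zero_iff_lt.mpr (by omega), zero_mul, zero_smul]
  have swap : Y ^ r₂ * X ^ r₁ * Z ^ r₃ * (Y ^ s₂ * X ^ s₁ * Z ^ s₃) =
      Y ^ r₂ * (X ^ r₁ * Y ^ s₂) * (X ^ s₁ * Z ^ (r₃ + s₃)) := by
    have hZ : Commute (Z ^ r₃) (Y ^ s₂ * X ^ s₁) :=
      ((hY.pow_pow _ _).symm).mul_right ((hX.pow_pow _ _).symm)
    rw [mul_assoc _ (Z ^ r₃), ← mul_assoc (Z ^ r₃), hZ.eq, pow_add]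
    simp only [mul_assoc]
  simp only [h]
  rw [smul_mul_smul_comm, swap, order, mul_sum, sum_mul, smul_sum]
  refine sum_congr rfl fun l hl => ?_
  have hl' := mem_range.mp hl
  have hr : l ≤ r₁ := by omega
  have hs : l ≤ s₂ := by omega
  have mono : Y ^ r₂ * (Y ^ (s₂ - l) * X ^ (r₁ - l) * Z ^ l) * (X ^ s₁ * Z ^ (r₃ + s₃)) =
      Y ^ (r₂ + s₂ - l) * X ^ (r₁ + s₁ - l) * Z ^ (r₃ + s₃ + l) := by
    have hZ : Commute (Z ^ l) (X ^ s₁) := (hX.pow_pow _ _).symm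
    rw [show r₂ + s₂ - l = r₂ + (s₂ - l) by omega, show r₁ + s₁ - l = r₁ - l + s₁ by omega,
      add_comm _ l, pow_add Y, pow_add X, pow_add Z l]
    simp only [mul_assoc]
    rw [← mul_assoc (Z ^ l) (X ^ s₁), hZ.eq, mul_assoc]
  rw [mul_smul_comm, smul_mul_assoc, mono, ← Nat.cast_smul_eq_nsmul k, smul_smul, smul_smul,
    heisenberg_coeff hr hs]

/-- A finitely supported sequence of divided powers of `A` forces `A` to be nilpotent. -/
theorem isNilpotent_of_dividedPow {k R ι : Type*} [Field k] [CharZero k] [Ring R] [Algebra k R]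
    {c : ι → R} (hc : (Function.support c).Finite) {f : ℕ → ι} (hf : Function.Injective f)
    {A : R} (h : ∀ n : ℕ, c (f n) = ((n.factorial : ℕ) : k)⁻¹ • A ^ n) : IsNilpotent A := by
  obtain ⟨n, hn⟩ := (hc.preimage hf.injOn).exists_notMem
  refine ⟨n, ?_⟩
  have h1 : c (f n) = 0 := by simpa using hn
  rw [h, smul_eq_zero] at h1
  exact h1.resolve_left (inv_ne_zero (by exact_mod_cast n.factorial_ne_zero))

/-- A sequence with `a 1 * a n = (n + 1) • a (n + 1)` consists of divided powers of `a 1`. -/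
theorem eq_dividedPow {k R : Type*} [Field k] [CharZero k] [Ring R] [Algebra k R]
    {a : ℕ → R} (h0 : a 0 = 1) (h : ∀ n : ℕ, a 1 * a n = ((n + 1 : ℕ) : k) • a (n + 1))
    (n : ℕ) : a n = ((n.factorial : ℕ) : k)⁻¹ • a 1 ^ n := by
  induction n with
  | zero => simp [h0]
  | succ n ih =>
    have hn : ((n + 1 : ℕ) : k) ≠ 0 := by exact_mod_cast n.succ_ne_zero
    rw [← inv_smul_smul₀ hn (a (n + 1)), ← h, ih, mul_smul_comm, smul_smul, ← pow_succ',
      Nat.factorial_succ, Nat.cast_mul, mul_inv]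

/-- Heisenberg relation with a single term on the right-hand side. -/
theorem HeisRel.mul_eq_of_min_eq_zero {k : Type*} [Field k] {d : ℕ}
    {c : ℕ × ℕ × ℕ → Matrix (Fin d) (Fin d) k} (h : HeisRel k d c) {r₁ s₂ : ℕ}
    (h0 : min r₁ s₂ = 0) (r₂ r₃ s₁ s₃ : ℕ) :
    c (r₁, r₂, r₃) * c (s₁, s₂, s₃) =
      (((r₁ + s₁).choose s₁ * (r₂ + s₂).choose r₂ * (r₃ + s₃).choose s₃ : ℕ) : k) •
        c (r₁ + s₁, r₂ + s₂, r₃ + s₃) := by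
  rw [h, h0, Nat.add_choose r₃ s₃]
  simp

/-- Over a field of characteristic zero, a finitely supported family `c` of `d × d`
matrices with `c_(0,0,0) = 1` satisfies the Heisenberg fundamental relation if and only if
there are nilpotent matrices `X`, `Y` whose commutator `Z := X*Y - Y*X` is nilpotent and
commutes with `X` and `Y`, such that `c_(n,m,l) = (n!·m!·l!)⁻¹ • (Y^m * X^n * Z^l)`;
in which case necessarily `X = c_(1,0,0)`, `Y = c_(0,1,0)` and `Z = c_(0,0,1)`. -/
theorem stmt14 (k : Type*) [Field k] [CharZero k] (d : ℕ)
    (c : ℕ × ℕ × ℕ → Matrix (Fin d) (Fin d) k) (hc : (Function.support c).Finite)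
    (h0 : c (0, 0, 0) = 1) :
    (HeisRel k d c ↔
      ∃ X Y : Matrix (Fin d) (Fin d) k,
        IsNilpotent X ∧ IsNilpotent Y ∧ IsNilpotent (X * Y - Y * X) ∧
        X * (X * Y - Y * X) = (X * Y - Y * X) * X ∧
        Y * (X * Y - Y * X) = (X * Y - Y * X) * Y ∧
        ∀ n m l : ℕ, c (n, m, l) =
          (((n.factorial * m.factorial * l.factorial : ℕ) : k))⁻¹ •
            (Y ^ m * X ^ n * (X * Y - Y * X) ^ l)) ∧
    (∀ X Y : Matrix (Fin d) (Fin d) k,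
      (∀ n m l : ℕ, c (n, m, l) =
          (((n.factorial * m.factorial * l.factorial : ℕ) : k))⁻¹ •
            (Y ^ m * X ^ n * (X * Y - Y * X) ^ l)) →
      X = c (1, 0, 0) ∧ Y = c (0, 1, 0) ∧ X * Y - Y * X = c (0, 0, 1)) := by
  have forward : HeisRel k d c → ∃ X Y : Matrix (Fin d) (Fin d) k,
      IsNilpotent X ∧ IsNilpotent Y ∧ IsNilpotent (X * Y - Y * X) ∧
      X * (X * Y - Y * X) = (X * Y - Y * X) * X ∧
      Y * (X * Y - Y * X) = (X * Y - Y * X) * Y ∧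
      ∀ n m l : ℕ, c (n, m, l) =
        (((n.factorial * m.factorial * l.factorial : ℕ) : k))⁻¹ •
          (Y ^ m * X ^ n * (X * Y - Y * X) ^ l) := by
    intro h
    have hZ : c (1, 0, 0) * c (0, 1, 0) - c (0, 1, 0) * c (1, 0, 0) = c (0, 0, 1) := by
      rw [h, h]
      simp [Finset.sum_range_succ]
    have hXpow := eq_dividedPow (k := k) (a := fun n => c (n, 0, 0)) h0 fun n => by
      simpa [add_comm] using h.mul_eq_of_min_eq_zero (r₁ := 1) (s₂ := 0) rfl 0 0 n 0
    have hYpow := eq_dividedPow (k := k) (a := fun n => c (0, n, 0)) h0 fun n => by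
      simpa [add_comm] using h.mul_eq_of_min_eq_zero (r₁ := 0) (s₂ := n) (by simp) 1 0 0 0
    have hZpow := eq_dividedPow (k := k) (a := fun n => c (0, 0, n)) h0 fun n => by
      simpa [add_comm] using h.mul_eq_of_min_eq_zero (r₁ := 0) (s₂ := 0) rfl 0 1 0 n
    refine ⟨c (1, 0, 0), c (0, 1, 0), ?_⟩
    rw [hZ]
    refine ⟨isNilpotent_of_dividedPow hc (fun a b hab => by simpa using hab) hXpow,
      isNilpotent_of_dividedPow hc (fun a b hab => by simpa using hab) hYpow,
      isNilpotent_of_dividedPow hc (fun a b hab => by simpa using hab) hZpow, ?_, ?_, ?_⟩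
    · rw [h.mul_eq_of_min_eq_zero (by simp), h.mul_eq_of_min_eq_zero (by simp)]
      simp
    · rw [h.mul_eq_of_min_eq_zero (by simp), h.mul_eq_of_min_eq_zero (by simp)]
      simp
    · intro n m l
      have h1 : c (0, m, 0) * c (n, 0, 0) * c (0, 0, l) = c (n, m, l) := by
        rw [h.mul_eq_of_min_eq_zero (by simp)]
        simp only [zero_add, add_zero, Nat.choose_self, mul_one, Nat.cast_one, one_smul]
        rw [h.mul_eq_of_min_eq_zero (by simp)]
        simp
      have hX := hXpow n
      have hY := hYpow m
      have hL := hZpow l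
      beta_reduce at hX hY hL
      rw [← h1, hX, hY, hL, smul_mul_smul_comm, smul_mul_smul_comm]
      congr 1
      push_cast
      rw [mul_inv, mul_inv, mul_comm (m.factorial : k)⁻¹]
  refine ⟨⟨forward, ?_⟩, fun X Y h => ⟨?_, ?_, ?_⟩⟩
  · rintro ⟨X, Y, -, -, -, hX, hY, h⟩
    exact HeisRel.of_eq (add_sub_cancel _ _).symm hX hY h
  all_goals simp [h]
end

section
/- Let k be a field of characteristic p > 0, d ∈ ℕ with p ≥ 2d, and c : ℕ × ℕ × ℕ → Matrix (Fin d) (Fin d) k a finitely supported family with c_{(0,0,0)} = 1 satisfying the Heisenberg fundamental relation (for all triples r = (r₁,r₂,r₃), s = (s₁,s₂,s₃): c_r * c_s = Σ_{l=0}^{min(r₁,s₂)} ( (r₁+s₁−l).choose s₁ · (r₂+s₂−l).choose r₂ · ((r₃+s₃+l)!/(r₃!·s₃!·l!)) : k ) • c_{(r₁+s₁−l, r₂+s₂−l, r₃+s₃+l)}). For m ∈ ℕ set X_m := c_{(p^m,0,0)}, Y_m := c_{(0,p^m,0)}, Z_m := c_{(0,0,p^m)}. Then Z_m = X_m*Y_m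 − Y_m*X_m for every m, and X_m*Y_n = Y_n*X_m whenever m ≠ n. -/
/-- The divided power relation `D a * D b = (a + b choose a) • D (a + b)`. -/
def IsDividedPowerFamily (k : Type*) {A : Type*} [Field k] [Ring A] [Algebra k A]
    (D : ℕ → A) : Prop :=
  ∀ a b : ℕ, D a * D b = (((a + b).choose a : ℕ) : k) • D (a + b)

theorem Matrix.pow_card_eq_zero_of_isNilpotent {k n : Type*} [Field k] [Fintype n]
    [DecidableEq n] {M : Matrix n n k} (hM : IsNilpotent M) : M ^ Fintype.card n = 0 := by
  have h := (Matrix.isNilpotent_charpoly_sub_pow_of_isNilpotent hM).eq_zero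
  have h2 := Matrix.aeval_self_charpoly M
  rw [sub_eq_zero.mp h] at h2
  simpa using h2

theorem cast_choose_pow_mul (k : Type*) [Field k] (p : ℕ) [CharP k p] [Fact p.Prime]
    (j n m : ℕ) :
    (((p ^ j * n).choose (p ^ j * m) : ℕ) : k) = ((n.choose m : ℕ) : k) := by
  induction j with
  | zero => simp
  | succ j ih =>
    rw [← ih, CharP.natCast_eq_natCast k p, pow_succ', mul_assoc, mul_assoc]
    exact Choose.choose_mul_mul_modEq_choose_nat

theorem cast_choose_mod_ne_zero (k : Type*) [Field k] (p : ℕ) [CharP k p] [Fact p.Prime]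
    (u : ℕ) : ((u.choose (u % p) : ℕ) : k) ≠ 0 := by
  have hp := (Fact.out : p.Prime).pos
  have h : u.choose (u % p) ≡ 1 [MOD p] := by
    refine Choose.choose_modEq_choose_mod_mul_choose_div_nat.trans ?_
    rw [Nat.mod_mod, Nat.choose_self, Nat.div_eq_of_lt (Nat.mod_lt u hp)]
    simp [Nat.ModEq.refl]
  rw [(CharP.natCast_eq_natCast k p).mpr h]
  simp

namespace IsDividedPowerFamily

theorem pow_eq_factorial_smul {k A : Type*} [Field k] [Ring A] [Algebra k A] {p : ℕ}
    [CharP k p] [Fact p.Prime] {D : ℕ → A} (hD : IsDividedPowerFamily k D) (hD0 : D 0 = 1)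
    (j t : ℕ) : D (p ^ j) ^ t = ((t.factorial : ℕ) : k) • D (p ^ j * t) := by
  induction t with
  | zero => simp [hD0]
  | succ t ih =>
    have h : (((p ^ j * t + p ^ j).choose (p ^ j * t) : ℕ) : k) = ((t + 1 : ℕ) : k) := by
      have := cast_choose_pow_mul k p j (t + 1) t
      rwa [mul_add, mul_one, Nat.choose_succ_self_right] at this
    rw [pow_succ, ih, smul_mul_assoc, hD, h, smul_smul, ← Nat.cast_mul, mul_comm t.factorial,
      ← Nat.factorial_succ, mul_add, mul_one]

theorem eq_zero_of_le_mod {k : Type*} [Field k] {p : ℕ} [CharP k p] [Fact p.Prime] {d : ℕ}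
    {D : ℕ → Matrix (Fin d) (Fin d) k} (hD : IsDividedPowerFamily k D) (hD0 : D 0 = 1)
    (j u : ℕ) (hu : d ≤ u % p) : D (p ^ j * u) = 0 := by
  have hp : p.Prime := Fact.out
  have hnil : IsNilpotent (D (p ^ j)) := ⟨p, by
    rw [hD.pow_eq_factorial_smul hD0,
      (CharP.cast_eq_zero_iff k p _).mpr (hp.dvd_factorial.mpr le_rfl), zero_smul]⟩
  have hpow := Matrix.pow_card_eq_zero_of_isNilpotent hnil
  rw [Fintype.card_fin] at hpow
  have ht := hD.pow_eq_factorial_smul hD0 j (u % p)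
  rw [pow_eq_zero_of_le hu hpow, eq_comm, smul_eq_zero] at ht
  have hfac : (((u % p).factorial : ℕ) : k) ≠ 0 := by
    rw [Ne, CharP.cast_eq_zero_iff k p, hp.dvd_factorial, not_le]
    exact Nat.mod_lt u hp.pos
  have hmul := hD (p ^ j * (u % p)) (p ^ j * (u - u % p))
  rw [ht.resolve_left hfac, zero_mul, ← mul_add, Nat.add_sub_of_le (Nat.mod_le u p),
    cast_choose_pow_mul, eq_comm, smul_eq_zero] at hmul
  exact hmul.resolve_left (cast_choose_mod_ne_zero k p u)

/-- If `0 < l < p ^ m`, the lowest nonzero base-`p` digits of `l` and `p ^ m - l` add up to `p`,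
so one of them is at least `d`. -/
theorem eq_zero_or_eq_zero {k : Type*} [Field k] {p : ℕ} [CharP k p] [Fact p.Prime] {d : ℕ}
    (hpd : 2 * d ≤ p) {D E : ℕ → Matrix (Fin d) (Fin d) k}
    (hD : IsDividedPowerFamily k D) (hD0 : D 0 = 1)
    (hE : IsDividedPowerFamily k E) (hE0 : E 0 = 1)
    {l m : ℕ} (hl : 0 < l) (hlm : l < p ^ m) : D l = 0 ∨ E (p ^ m - l) = 0 := by
  have hp : p.Prime := Fact.out
  obtain ⟨j, u, hu, rfl⟩ := Nat.exists_eq_pow_mul_and_not_dvd hl.ne' p hp.ne_one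
  have hu0 : 0 < u := Nat.pos_of_mul_pos_left hl
  have hjm : j < m := (Nat.pow_lt_pow_iff_right hp.one_lt).mp
    ((Nat.le_mul_of_pos_right _ hu0).trans_lt hlm)
  obtain ⟨i, rfl⟩ := Nat.exists_eq_add_of_lt hjm
  rw [add_assoc, pow_add] at hlm ⊢
  have hui : u < p ^ (i + 1) := Nat.lt_of_mul_lt_mul_left hlm
  rw [← Nat.mul_sub]
  by_cases h : d ≤ u % p
  · exact Or.inl (hD.eq_zero_of_le_mod hD0 j u h)
  · refine Or.inr (hE.eq_zero_of_le_mod hE0 j _ ?_)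
    have hdvd : p ∣ u % p + (p ^ (i + 1) - u) % p := by
      rw [Nat.dvd_iff_mod_eq_zero, ← Nat.add_mod, Nat.add_sub_of_le hui.le, pow_succ,
        Nat.mul_mod_left]
    have hpos : 0 < u % p := Nat.pos_of_ne_zero fun h0 => hu (Nat.dvd_of_mod_eq_zero h0)
    have := Nat.le_of_dvd (by omega) hdvd
    omega

theorem sub_pow_eq_zero {k : Type*} [Field k] {p : ℕ} [CharP k p] [Fact p.Prime] {d : ℕ}
    (hpd : 2 * d ≤ p) {D : ℕ → Matrix (Fin d) (Fin d) k} (hD : IsDividedPowerFamily k D)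
    (hD0 : D 0 = 1) {i m : ℕ} (him : i < m) : D (p ^ m - p ^ i) = 0 := by
  have hp : p.Prime := Fact.out
  obtain ⟨j, rfl⟩ := Nat.exists_eq_add_of_lt him
  have h : p ^ (i + j + 1) - p ^ i = p ^ i * ((p - 1) + p * (p ^ j - 1)) := by
    have : 0 < p ^ j := Nat.pow_pos hp.pos
    obtain ⟨q, hq⟩ := Nat.exists_eq_add_of_lt this
    obtain ⟨r, rfl⟩ := Nat.exists_eq_add_of_lt hp.pos
    rw [pow_succ, pow_add, hq]
    simp only [Nat.add_sub_cancel, zero_add]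
    rw [Nat.sub_eq_iff_eq_add (by rw [mul_assoc]; exact Nat.le_mul_of_pos_right _ (by positivity))]
    ring
  rw [h]
  apply hD.eq_zero_of_le_mod hD0
  have := hp.two_le
  rw [Nat.add_mul_mod_self_left, Nat.mod_eq_of_lt (by omega)]
  omega

end IsDividedPowerFamily

namespace HeisRel

variable {k : Type*} [Field k] {d : ℕ} {c : ℕ × ℕ × ℕ → Matrix (Fin d) (Fin d) k}

theorem isDividedPowerFamily_x (h : HeisRel k d c) :
    IsDividedPowerFamily k fun n => c (n, 0, 0) := fun a b => by
  rw [Nat.choose_symm_add]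
  simpa using h (a, 0, 0) (b, 0, 0)

theorem isDividedPowerFamily_y (h : HeisRel k d c) :
    IsDividedPowerFamily k fun n => c (0, n, 0) := fun a b => by
  simpa using h (0, a, 0) (0, b, 0)

theorem isDividedPowerFamily_z (h : HeisRel k d c) :
    IsDividedPowerFamily k fun n => c (0, 0, n) := fun a b => by
  rw [Nat.choose_symm_add, Nat.add_choose]
  simpa using h (0, 0, a) (0, 0, b)

theorem y_mul_x (h : HeisRel k d c) (n m : ℕ) : c (0, m, 0) * c (n, 0, 0) = c (n, m, 0) := by
  simpa using h (0, m, 0) (n, 0, 0)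

theorem z_mul_y_mul_x (h : HeisRel k d c) (n m l : ℕ) :
    c (0, 0, l) * (c (0, m, 0) * c (n, 0, 0)) = c (n, m, l) := by
  rw [h.y_mul_x]
  simpa [Nat.div_self l.factorial_pos] using h (0, 0, l) (n, m, 0)

theorem x_mul_y (h : HeisRel k d c) (n m : ℕ) :
    c (n, 0, 0) * c (0, m, 0) =
      ∑ l ∈ Finset.range (min n m + 1), c (n - l, m - l, l) := by
  rw [h (n, 0, 0) (0, m, 0)]
  refine Finset.sum_congr rfl fun l _ => ?_
  simp [Nat.div_self l.factorial_pos]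

theorem eq_zero_of_x (h : HeisRel k d c) {n : ℕ} (hn : c (n, 0, 0) = 0) (m l : ℕ) :
    c (n, m, l) = 0 := by
  rw [← h.z_mul_y_mul_x, hn, mul_zero, mul_zero]

theorem eq_zero_of_y (h : HeisRel k d c) {m : ℕ} (hm : c (0, m, 0) = 0) (n l : ℕ) :
    c (n, m, l) = 0 := by
  rw [← h.z_mul_y_mul_x, hm, zero_mul, mul_zero]

theorem eq_zero_of_z (h : HeisRel k d c) {l : ℕ} (hl : c (0, 0, l) = 0) (n m : ℕ) :
    c (n, m, l) = 0 := by
  rw [← h.z_mul_y_mul_x, hl, zero_mul]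

/-- In the expansion of the product of the `p ^ m`-th and `p ^ n`-th divided powers, only the
extreme terms survive. -/
theorem x_pow_mul_y_pow {p : ℕ} [CharP k p] [Fact p.Prime] (h : HeisRel k d c)
    (hpd : 2 * d ≤ p) (h0 : c (0, 0, 0) = 1) (m n : ℕ) :
    c (p ^ m, 0, 0) * c (0, p ^ n, 0) = c (0, p ^ n, 0) * c (p ^ m, 0, 0) +
      c (p ^ m - min (p ^ m) (p ^ n), p ^ n - min (p ^ m) (p ^ n), min (p ^ m) (p ^ n)) := by
  have hp : p.Prime := Fact.out
  have hpos : 0 < min (p ^ m) (p ^ n) := lt_min (Nat.pow_pos hp.pos) (Nat.pow_pos hp.pos)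
  have hmid : ∀ l, 0 < l → l < p ^ m → c (p ^ m - l, p ^ n - l, l) = 0 := fun l hl hlm =>
    (h.isDividedPowerFamily_z.eq_zero_or_eq_zero hpd h0 h.isDividedPowerFamily_x h0 hl hlm).elim
      (fun hz => h.eq_zero_of_z hz _ _) (fun hx => h.eq_zero_of_x hx _ _)
  rw [h.x_mul_y, h.y_mul_x, Finset.sum_range_succ,
    Finset.sum_eq_single_of_mem 0 (Finset.mem_range.mpr hpos)]
  · simp
  · intro l hl hl0
    exact hmid l (Nat.pos_of_ne_zero hl0) ((Finset.mem_range.mp hl).trans_le (min_le_left _ _))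

end HeisRel

/-- Over a field of characteristic `p > 0` with `p ≥ 2d`, if a finitely supported family `c`
of `d × d` matrices with `c_(0,0,0) = 1` satisfies the Heisenberg fundamental relation, then
with `X_m := c_(p^m,0,0)`, `Y_m := c_(0,p^m,0)`, `Z_m := c_(0,0,p^m)` one has
`Z_m = [X_m, Y_m]` for all `m`, and `X_m` commutes with `Y_n` whenever `m ≠ n`. -/
theorem stmt15 (k : Type*) [Field k] (p : ℕ) [CharP k p] (hp : 0 < p) (d : ℕ)
    (hpd : 2 * d ≤ p)
    (c : ℕ × ℕ × ℕ → Matrix (Fin d) (Fin d) k) (hc : (Function.support c).Finite)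
    (h0 : c (0, 0, 0) = 1) (hrel : HeisRel k d c) :
    (∀ m : ℕ, c (0, 0, p ^ m) =
        c (p ^ m, 0, 0) * c (0, p ^ m, 0) - c (0, p ^ m, 0) * c (p ^ m, 0, 0)) ∧
    (∀ m n : ℕ, m ≠ n →
        c (p ^ m, 0, 0) * c (0, p ^ n, 0) = c (0, p ^ n, 0) * c (p ^ m, 0, 0)) := by
  have : Fact p.Prime := ⟨(CharP.char_is_prime_or_zero k p).resolve_right hp.ne'⟩
  refine ⟨fun m => ?_, fun m n hmn => ?_⟩
  · rw [hrel.x_pow_mul_y_pow hpd h0]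
    simp
  · rw [hrel.x_pow_mul_y_pow hpd h0, add_eq_left]
    rcases hmn.lt_or_gt with hlt | hlt
    · rw [min_eq_left (Nat.pow_le_pow_right hp hlt.le)]
      exact hrel.eq_zero_of_y (hrel.isDividedPowerFamily_y.sub_pow_eq_zero hpd h0 hlt) _ _
    · rw [min_eq_right (Nat.pow_le_pow_right hp hlt.le)]
      exact hrel.eq_zero_of_x (hrel.isDividedPowerFamily_x.sub_pow_eq_zero hpd h0 hlt) _ _
end

section
/- Let k be a field and d ≥ 1. Let X, Y be nilpotent d×d matrices over k, set Z := X*Y − Y*X, and assume Z is nilpotent, X*Z = Z*X and Y*Z = Z*Y. Assume either k has characteristic zero or k has characteristic p with p > 2d. Then exp(X) * exp(Y) = exp( X + Y + ((2 : k))⁻¹ • Z ), where for a d×d matrix N we set exp(N) := Σ_{j=0}^{d−1} ((j! : k))⁻¹ • N^j. -/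
open Finset

section Vanishing

variable {k : Type*} [Field k]

/-- In an algebra where `Z = X * Y - Y * X` commutes with `X` and `Y`, the products of `n` elements
of `span {X, Y}` are spanned by the ordered monomials of weight `n`, where `Z` has weight two. -/
lemma span_pair_pow_le {A : Type*} [Ring A] [Algebra k A] {X Y Z : A}
    (hZ : X * Y = Y * X + Z) (hXZ : Commute X Z) (hYZ : Commute Y Z) (n : ℕ) :
    Submodule.span k {X, Y} ^ n ≤
      Submodule.span k {m | ∃ a b c : ℕ, a + b + 2 * c = n ∧ m = X ^ a * Y ^ b * Z ^ c} := by
  have comm (a : ℕ) : Y * X ^ (a + 1) = X ^ (a + 1) * Y - (a + 1 : k) • (X ^ a * Z) := by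
    induction a with
    | zero => simp [hZ]
    | succ a ih =>
      have h1 : Y * X ^ (a + 1 + 1) = (Y * X ^ (a + 1)) * X := by rw [pow_succ X (a + 1), mul_assoc]
      have h2 : Y * X = X * Y - Z := by rw [hZ]; abel
      rw [h1, ih, sub_mul, mul_assoc, h2, smul_mul_assoc, mul_assoc, ← hXZ.eq, mul_sub,
        ← mul_assoc, ← mul_assoc, ← pow_succ, ← pow_succ]
      push_cast
      module
  induction n with
  | zero =>
    rw [pow_zero, Submodule.one_eq_span, Submodule.span_le, Set.singleton_subset_iff]
    exact Submodule.subset_span ⟨0, 0, 0, by simp⟩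
  | succ n ih =>
    rw [pow_succ']
    refine (mul_le_mul' le_rfl ih).trans ?_
    rw [Submodule.span_mul_span, Submodule.span_le]
    rintro _ ⟨s, hs, _, ⟨a, b, c, hn, rfl⟩, rfl⟩
    have hYb (b : ℕ) : Z * Y ^ b = Y ^ b * Z := ((hYZ.pow_left b).eq).symm
    rcases hs with rfl | rfl
    · exact Submodule.subset_span ⟨a + 1, b, c, by omega, by simp only [pow_succ', mul_assoc]⟩
    · rcases a with _ | a
      · exact Submodule.subset_span
          ⟨0, b + 1, c, by omega, by simp only [pow_zero, one_mul, pow_succ', mul_assoc]⟩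
      · have key : s * (X ^ (a + 1) * s ^ b * Z ^ c) =
            X ^ (a + 1) * s ^ (b + 1) * Z ^ c - (a + 1 : k) • (X ^ a * s ^ b * Z ^ (c + 1)) := by
          rw [← mul_assoc, ← mul_assoc, comm, sub_mul, sub_mul, smul_mul_assoc, smul_mul_assoc,
            mul_assoc (X ^ a) Z, hYb, pow_succ' s, pow_succ' Z]
          simp only [mul_assoc]
        change s * (X ^ (a + 1) * s ^ b * Z ^ c) ∈ _
        rw [key]
        exact Submodule.sub_mem _ (Submodule.subset_span ⟨a + 1, b + 1, c, by omega, rfl⟩)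
          (Submodule.smul_mem _ _ (Submodule.subset_span ⟨a, b, c + 1, by omega, rfl⟩))

lemma isNilpotent_span_pair {A : Type*} [Ring A] [Algebra k A] {X Y Z : A}
    (hZ : X * Y = Y * X + Z) (hXZ : Commute X Z) (hYZ : Commute Y Z)
    (hX : IsNilpotent X) (hY : IsNilpotent Y) (hZn : IsNilpotent Z) :
    IsNilpotent (Submodule.span k {X, Y}) := by
  obtain ⟨p, hp⟩ := hX
  obtain ⟨q, hq⟩ := hY
  obtain ⟨r, hr⟩ := hZn
  refine ⟨p + q + 2 * r, le_bot_iff.1 ((span_pair_pow_le hZ hXZ hYZ _).trans ?_)⟩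
  rw [Submodule.span_le]
  rintro _ ⟨a, b, c, h, rfl⟩
  rw [SetLike.mem_coe, Submodule.mem_bot]
  obtain ha | hb | hc : p ≤ a ∨ q ≤ b ∨ r ≤ c := by omega
  · simp [pow_eq_zero_of_le ha hp]
  · simp [pow_eq_zero_of_le hb hq]
  · simp [pow_eq_zero_of_le hc hr]

/-- A nilpotent space of `d × d` matrices has nilpotency index at most `d`. -/
lemma Matrix.submodule_pow_eq_bot {d : ℕ} {J : Submodule k (Matrix (Fin d) (Fin d) k)}
    (hJ : IsNilpotent J) {n : ℕ} (hn : d ≤ n) : J ^ n = ⊥ := by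
  obtain ⟨M, hM⟩ := hJ
  let f : Matrix (Fin d) (Fin d) k →ₗ[k] (Fin d → k) →ₗ[k] (Fin d → k) :=
    Matrix.toLin'.toLinearMap
  have hf (A B : Matrix (Fin d) (Fin d) k) (v : Fin d → k) : f (A * B) v = f A (f B v) := by
    simp [f, Matrix.toLin'_mul]
  let V (n : ℕ) : Submodule k (Fin d → k) := Submodule.map₂ f (J ^ n) ⊤
  have anti : Antitone V := by
    refine antitone_nat_of_succ_le fun n ↦ Submodule.map₂_le.2 fun A hA v _ ↦ ?_
    rw [pow_succ] at hA
    induction hA using Submodule.mul_induction_on' with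
    | mem_mul_mem A hA B hB => rw [hf]; exact Submodule.apply_mem_map₂ _ hA trivial
    | add A _ B _ ihA ihB => rw [map_add]; exact add_mem ihA ihB
  have maps {A} (hA : A ∈ J) {n} {v} (hv : v ∈ V n) : f A v ∈ V (n + 1) := by
    suffices V n ≤ (V (n + 1)).comap (f A) from this hv
    refine Submodule.map₂_le.2 fun B hB w _ ↦ ?_
    rw [Submodule.mem_comap, ← hf]
    exact Submodule.apply_mem_map₂ _ (by rw [pow_succ']; exact Submodule.mul_mem_mul hA hB) trivial
  have step {n} (h : V n ≤ V (n + 1)) : V (n + 1) ≤ V (n + 2) := by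
    refine Submodule.map₂_le.2 fun A hA v _ ↦ ?_
    rw [pow_succ'] at hA
    induction hA using Submodule.mul_induction_on' with
    | mem_mul_mem A hA B hB =>
      rw [hf]; exact maps hA (h (Submodule.apply_mem_map₂ _ hB trivial))
    | add A _ B _ ihA ihB => rw [map_add]; exact add_mem ihA ihB
  have stable {n} (h : V n ≤ V (n + 1)) (j : ℕ) : V n ≤ V (n + j) ∧ V (n + j) ≤ V (n + j + 1) := by
    induction j with
    | zero => exact ⟨le_rfl, h⟩
    | succ j ih => exact ⟨ih.1.trans ih.2, step ih.2⟩
  have hVM : V M = ⊥ := by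
    simp only [V, hM]
    exact Submodule.map₂_bot_left _ _
  have dim (n : ℕ) : V n = ⊥ ∨ n + Module.finrank k (V n) ≤ d := by
    induction n with
    | zero => exact .inr (by simpa using (V 0).finrank_le)
    | succ n ih =>
      rcases ih with h | h
      · exact .inl (le_bot_iff.1 (h ▸ anti n.le_succ))
      · by_cases hle : V n ≤ V (n + 1)
        · left
          exact le_bot_iff.1 ((anti n.le_succ).trans
            (((stable hle M).1.trans (anti (Nat.le_add_left M n))).trans hVM.le))
        · have := Submodule.finrank_lt_finrank_of_lt (lt_of_le_not_ge (anti n.le_succ) hle)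
          right; simp only [Nat.succ_eq_add_one] at this; omega
  have hVn : V n = ⊥ := by
    rcases dim n with h | h
    · exact h
    · exact Submodule.finrank_eq_zero.1 (by omega)
  refine (Submodule.eq_bot_iff _).2 fun A hA ↦ ?_
  refine Matrix.toLin'.injective (LinearMap.ext fun v ↦ ?_)
  have : f A v ∈ V n := Submodule.apply_mem_map₂ _ hA trivial
  rw [hVn, Submodule.mem_bot] at this
  simpa [f] using this

end Vanishing

section DividedPowers

variable {k A : Type*} [Field k] [Ring A] [Algebra k A]

/-- The divided power `a ^ n / n!`. -/
noncomputable def divPow (k : Type*) {A : Type*} [Field k] [Ring A] [Algebra k A] (a : A) (n : ℕ) :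
    A :=
  (n.factorial : k)⁻¹ • a ^ n

lemma divPow_zero (a : A) : divPow k a 0 = 1 := by simp [divPow]

lemma succ_smul_divPow_succ (a : A) {n : ℕ} (hn : ((n + 1 : ℕ) : k) ≠ 0) :
    ((n + 1 : ℕ) : k) • divPow k a (n + 1) = a * divPow k a n := by
  rw [divPow, divPow, smul_smul, Nat.factorial_succ, Nat.cast_mul, mul_inv, ← mul_assoc,
    mul_inv_cancel₀ hn, one_mul, mul_smul_comm, pow_succ']

lemma Commute.divPow_right {a b : A} (h : Commute a b) (n : ℕ) : Commute a (divPow k b n) :=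
  (h.pow_right n).smul_right _

lemma divPow_succ_mul {X Y Z : A} (hZ : X * Y = Y * X + Z) (hXZ : Commute X Z) {n : ℕ}
    (hn : ∀ m ≤ n, ((m + 1 : ℕ) : k) ≠ 0) :
    divPow k X (n + 1) * Y = Y * divPow k X (n + 1) + Z * divPow k X n := by
  induction n with
  | zero =>
    have h0 := succ_smul_divPow_succ X (hn 0 le_rfl)
    simp only [zero_add, Nat.cast_one, one_smul, divPow_zero, mul_one] at h0 ⊢
    rw [h0, hZ]
  | succ n ih =>
    have h1 := hn (n + 1) le_rfl
    have ih := ih fun m hm ↦ hn m (by omega)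
    have h2 := succ_smul_divPow_succ X h1
    have h3 := succ_smul_divPow_succ X (hn n (by omega))
    have h4 : X * Z = Z * X := hXZ
    rw [← smul_right_inj h1, smul_add, ← smul_mul_assoc, ← mul_smul_comm, h2, mul_assoc, ih,
      mul_add, ← mul_assoc, ← mul_assoc, hZ, add_mul, h4, mul_assoc Z, ← h3, mul_assoc]
    push_cast
    simp only [mul_smul_comm]
    module

/-- Recurrence for the Cauchy product of two sequences, the first of which consists of divided
powers. -/
lemma succ_smul_sum_divPow_mul (a : A) (u : ℕ → A) {n : ℕ}
    (hn : ∀ m ≤ n, ((m + 1 : ℕ) : k) ≠ 0) :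
    ((n + 1 : ℕ) : k) • ∑ p ∈ antidiagonal (n + 1), divPow k a p.1 * u p.2 =
      a * ∑ p ∈ antidiagonal n, divPow k a p.1 * u p.2 +
        ∑ p ∈ antidiagonal n, divPow k a p.1 * (((p.2 + 1 : ℕ) : k) • u (p.2 + 1)) := by
  have h : ((n + 1 : ℕ) : k) • ∑ p ∈ antidiagonal (n + 1), divPow k a p.1 * u p.2 =
      ∑ p ∈ antidiagonal (n + 1), ((p.1 : k) • divPow k a p.1) * u p.2 +
        ∑ p ∈ antidiagonal (n + 1), divPow k a p.1 * ((p.2 : k) • u p.2) := by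
    rw [smul_sum, ← sum_add_distrib]
    refine sum_congr rfl fun p hp ↦ ?_
    rw [← mem_antidiagonal.1 hp, Nat.cast_add, add_smul, smul_mul_assoc, mul_smul_comm]
  rw [h, Nat.sum_antidiagonal_succ, Nat.sum_antidiagonal_succ']
  simp only [Nat.cast_zero, zero_smul, zero_mul, mul_zero, zero_add]
  congr 1
  rw [mul_sum]
  refine sum_congr rfl fun p hp ↦ ?_
  have := mem_antidiagonal.1 hp
  rw [succ_smul_divPow_succ a (hn p.1 (by omega)), mul_assoc]

/-- The coefficients of `exp (t ^ 2 b)`. -/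
noncomputable def evenDivPow (k : Type*) {A : Type*} [Field k] [Ring A] [Algebra k A] (b : A)
    (n : ℕ) : A :=
  if Even n then divPow k b (n / 2) else 0

lemma evenDivPow_two_mul (b : A) (n : ℕ) : evenDivPow k b (2 * n) = divPow k b n := by
  simp [evenDivPow]

lemma evenDivPow_two_mul_add_one (b : A) (n : ℕ) : evenDivPow k b (2 * n + 1) = 0 := by
  simp [evenDivPow]

lemma add_two_smul_evenDivPow (b : A) {n : ℕ} (hn : ((n + 2 : ℕ) : k) ≠ 0) :
    ((n + 2 : ℕ) : k) • evenDivPow k b (n + 2) = ((2 : k) • b) * evenDivPow k b n := by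
  rcases Nat.even_or_odd' n with ⟨c, rfl | rfl⟩
  · have h : 2 * c + 2 = 2 * (c + 1) := by ring
    rw [h, Nat.cast_mul] at hn
    rw [h, evenDivPow_two_mul, evenDivPow_two_mul, Nat.cast_mul, mul_smul,
      succ_smul_divPow_succ b (right_ne_zero_of_mul hn), smul_mul_assoc, Nat.cast_ofNat]
  · have h : 2 * c + 1 + 2 = 2 * (c + 1) + 1 := by ring
    rw [h, evenDivPow_two_mul_add_one, evenDivPow_two_mul_add_one, smul_zero, mul_zero]

/-- The Heisenberg case of the Baker–Campbell–Hausdorff formula, degree by degree. -/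
lemma sum_divPow_mul_divPow {X Y Z : A} (h2 : (2 : k) ≠ 0)
    (hZ : X * Y = Y * X + Z) (hXZ : Commute X Z) (hYZ : Commute Y Z) (n : ℕ)
    (hn : ∀ m < n, ((m + 1 : ℕ) : k) ≠ 0) :
    ∑ p ∈ antidiagonal n, divPow k X p.1 * divPow k Y p.2 =
      ∑ p ∈ antidiagonal n, divPow k (X + Y) p.1 * evenDivPow k ((2 : k)⁻¹ • Z) p.2 := by
  induction n using Nat.strong_induction_on with
  | _ n ih =>
    rcases n with _ | n
    · have := evenDivPow_two_mul (k := k) ((2 : k)⁻¹ • Z) 0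
      simp only [mul_zero] at this
      simp [divPow_zero, this]
    · have hn' : ∀ m ≤ n, ((m + 1 : ℕ) : k) ≠ 0 := fun m hm ↦ hn m (by omega)
      rw [← smul_right_inj (hn' n le_rfl), succ_smul_sum_divPow_mul _ _ hn',
        succ_smul_sum_divPow_mul _ _ hn', ← ih n (by omega) (fun m hm ↦ hn m (by omega)), add_mul,
        add_assoc]
      congr 1
      have hY : ∑ p ∈ antidiagonal n, divPow k X p.1 *
            (((p.2 + 1 : ℕ) : k) • divPow k Y (p.2 + 1)) =
          ∑ p ∈ antidiagonal n, divPow k X p.1 * Y * divPow k Y p.2 := by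
        refine sum_congr rfl fun p hp ↦ ?_
        have := mem_antidiagonal.1 hp
        rw [succ_smul_divPow_succ Y (hn' p.2 (by omega)), mul_assoc]
      rw [hY]
      have hu1 : evenDivPow k ((2 : k)⁻¹ • Z) 1 = 0 := evenDivPow_two_mul_add_one _ 0
      rcases n with _ | n
      · simp [divPow_zero, hu1]
      · rw [Nat.sum_antidiagonal_succ, Nat.sum_antidiagonal_succ, Nat.sum_antidiagonal_succ']
        simp only [divPow_zero, one_mul, zero_add, hu1, smul_zero, mul_zero]
        have hG : ∑ p ∈ antidiagonal n, divPow k (X + Y) p.1 *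
              (((p.2 + 1 + 1 : ℕ) : k) • evenDivPow k ((2 : k)⁻¹ • Z) (p.2 + 1 + 1)) =
            Z * ∑ p ∈ antidiagonal n, divPow k X p.1 * divPow k Y p.2 := by
          rw [ih n (by omega) (fun m hm ↦ hn m (by omega)), mul_sum]
          refine sum_congr rfl fun p hp ↦ ?_
          have := mem_antidiagonal.1 hp
          rw [add_two_smul_evenDivPow _ (hn' (p.2 + 1) (by omega)), smul_smul,
            mul_inv_cancel₀ h2, one_smul, ← mul_assoc, ← mul_assoc,
            ((hXZ.add_left hYZ).symm.divPow_right p.1).eq]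
        rw [hG, mul_add, mul_sum, mul_sum, add_assoc, ← sum_add_distrib]
        congr 1
        refine sum_congr rfl fun p hp ↦ ?_
        have := mem_antidiagonal.1 hp
        rw [divPow_succ_mul hZ hXZ fun m hm ↦ hn' m (by omega), add_mul, mul_assoc, mul_assoc]

lemma divPow_add {a b : A} (h : Commute a b) {n : ℕ} (hn : (n.factorial : k) ≠ 0) :
    divPow k (a + b) n = ∑ p ∈ antidiagonal n, divPow k a p.1 * divPow k b p.2 := by
  rw [divPow, h.add_pow', smul_sum]
  refine sum_congr rfl fun p hp ↦ ?_
  have hp := mem_antidiagonal.1 hp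
  have hfac : ((n.choose p.1 : ℕ) : k) * p.1.factorial * p.2.factorial = n.factorial := by
    rw [← hp, Nat.choose_symm_add, ← Nat.add_choose_mul_factorial_mul_factorial p.1 p.2]; push_cast; rfl
  have h0 := hfac ▸ hn
  rw [divPow, divPow, smul_mul_smul_comm, ← Nat.cast_smul_eq_nsmul k, smul_smul]
  congr 1
  have h1 := right_ne_zero_of_mul h0
  have h2 := right_ne_zero_of_mul (left_ne_zero_of_mul h0)
  have h3 := left_ne_zero_of_mul (left_ne_zero_of_mul h0)
  rw [← hfac]
  field_simp

end DividedPowers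

lemma sum_range_sum_range_eq_sum_antidiagonal {M : Type*} [AddCommMonoid M] (f : ℕ → ℕ → M)
    (d : ℕ) (hf : ∀ a b, d ≤ a + b → f a b = 0) :
    ∑ a ∈ range d, ∑ b ∈ range d, f a b =
      ∑ n ∈ range d, ∑ p ∈ antidiagonal n, f p.1 p.2 := by
  simp only [Nat.sum_antidiagonal_eq_sum_range_succ f]
  rw [sum_range_diag_flip d f]
  refine sum_congr rfl fun a _ ↦ (sum_subset ?_ ?_).symm
  · exact range_subset_range.2 (Nat.sub_le d a)
  · intro b _ hb
    exact hf a b (by have := mem_range.not.1 hb; omega)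

lemma sum_range_two_mul {M : Type*} [AddCommMonoid M] (f : ℕ → M) (n : ℕ) :
    ∑ j ∈ range (2 * n), f j = ∑ c ∈ range n, (f (2 * c) + f (2 * c + 1)) := by
  induction n with
  | zero => simp
  | succ n ih => rw [sum_range_succ, ← ih, mul_add_one, sum_range_succ, sum_range_succ, add_assoc]


/-- The truncated exponential `exp(N) = ∑_{j=0}^{d-1} (j!)⁻¹ • N^j` of a `d × d` matrix. -/
noncomputable def texp {k : Type*} [Field k] {d : ℕ} (N : Matrix (Fin d) (Fin d) k) :
    Matrix (Fin d) (Fin d) k :=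
  ∑ j ∈ Finset.range d, ((j.factorial : k))⁻¹ • N ^ j

/-- Baker–Campbell–Hausdorff formula for the Heisenberg group: if `X`, `Y` are nilpotent
`d × d` matrices whose commutator `Z := X*Y - Y*X` is nilpotent and commutes with `X` and
`Y`, and the field has characteristic zero or characteristic `p > 2d`, then
`exp(X) * exp(Y) = exp(X + Y + (1/2) Z)`. -/
theorem stmt17 (k : Type*) [Field k] (d : ℕ) (hd : 1 ≤ d)
    (X Y : Matrix (Fin d) (Fin d) k) (hX : IsNilpotent X) (hY : IsNilpotent Y)
    (hZnil : IsNilpotent (X * Y - Y * X))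
    (hXZ : X * (X * Y - Y * X) = (X * Y - Y * X) * X)
    (hYZ : Y * (X * Y - Y * X) = (X * Y - Y * X) * Y)
    (hchar : CharZero k ∨ ∃ p : ℕ, CharP k p ∧ 2 * d < p) :
    texp X * texp Y = texp (X + Y + ((2 : k))⁻¹ • (X * Y - Y * X)) := by
  have hfac : ∀ n < d, (n.factorial : k) ≠ 0 := by
    rcases hchar with h | ⟨p, hp, hpd⟩
    · exact fun n _ ↦ Nat.cast_ne_zero.2 n.factorial_ne_zero
    · have hprime : p.Prime := (CharP.char_is_prime_or_zero k p).resolve_right (by omega)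
      intro n hn h
      rw [CharP.cast_eq_zero_iff k p, hprime.dvd_factorial] at h
      omega
  have h2 : (2 : k) ≠ 0 := by
    rcases hchar with h | ⟨p, hp, hpd⟩
    · exact two_ne_zero
    · intro h
      rw [← Nat.cast_ofNat, CharP.cast_eq_zero_iff k p] at h
      exact absurd (Nat.le_of_dvd two_pos h) (by omega)
  have hcast : ∀ n, n + 1 < d → ((n + 1 : ℕ) : k) ≠ 0 := fun n hn ↦ by
    have := hfac (n + 1) hn
    rw [Nat.factorial_succ, Nat.cast_mul] at this
    exact left_ne_zero_of_mul this
  set Z := X * Y - Y * X with hZdef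
  have hZ : X * Y = Y * X + Z := by rw [hZdef]; abel
  set J := Submodule.span k {X, Y}
  have hJ {n : ℕ} (hn : d ≤ n) : J ^ n = ⊥ :=
    Matrix.submodule_pow_eq_bot (isNilpotent_span_pair hZ hXZ hYZ hX hY hZnil) hn
  have hXJ : X ∈ J := Submodule.subset_span (by simp)
  have hYJ : Y ∈ J := Submodule.subset_span (by simp)
  have hZJ : (2 : k)⁻¹ • Z ∈ J ^ 2 := by
    rw [pow_two]
    exact Submodule.smul_mem _ _
      (sub_mem (Submodule.mul_mem_mul hXJ hYJ) (Submodule.mul_mem_mul hYJ hXJ))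
  have hXY (a b : ℕ) (h : d ≤ a + b) : divPow k X a * divPow k Y b = 0 := by
    rw [← Submodule.mem_bot k, ← hJ h, pow_add]
    exact Submodule.mul_mem_mul (Submodule.smul_mem _ _ (Submodule.pow_mem_pow _ hXJ _))
      (Submodule.smul_mem _ _ (Submodule.pow_mem_pow _ hYJ _))
  have hWZ (a b : ℕ) (h : d ≤ a + 2 * b) :
      divPow k (X + Y) a * divPow k ((2 : k)⁻¹ • Z) b = 0 := by
    rw [← Submodule.mem_bot k, ← hJ h, pow_add, pow_mul]
    exact Submodule.mul_mem_mul
      (Submodule.smul_mem _ _ (Submodule.pow_mem_pow _ (add_mem hXJ hYJ) _))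
      (Submodule.smul_mem _ _ (Submodule.pow_mem_pow _ hZJ _))
  have hWZ' (a b : ℕ) (h : d ≤ a + b) :
      divPow k (X + Y) a * evenDivPow k ((2 : k)⁻¹ • Z) b = 0 := by
    rcases Nat.even_or_odd' b with ⟨c, rfl | rfl⟩
    · rw [evenDivPow_two_mul, hWZ a c h]
    · rw [evenDivPow_two_mul_add_one, mul_zero]
  have hcomm : Commute (X + Y) ((2 : k)⁻¹ • Z) :=
    (Commute.add_left (show Commute X Z from hXZ) hYZ).smul_right _
  calc texp X * texp Y
      = ∑ a ∈ range d, ∑ b ∈ range d, divPow k X a * divPow k Y b := sum_mul_sum _ _ _ _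
    _ = ∑ n ∈ range d, ∑ p ∈ antidiagonal n, divPow k X p.1 * divPow k Y p.2 :=
        sum_range_sum_range_eq_sum_antidiagonal _ d hXY
    _ = ∑ n ∈ range d, ∑ p ∈ antidiagonal n,
          divPow k (X + Y) p.1 * evenDivPow k ((2 : k)⁻¹ • Z) p.2 :=
        sum_congr rfl fun n hn ↦ sum_divPow_mul_divPow h2 hZ hXZ hYZ n fun m hm ↦
          hcast m (by have := mem_range.1 hn; omega)
    _ = ∑ a ∈ range d, ∑ b ∈ range d,
          divPow k (X + Y) a * evenDivPow k ((2 : k)⁻¹ • Z) b :=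
        (sum_range_sum_range_eq_sum_antidiagonal
          (fun a b ↦ divPow k (X + Y) a * evenDivPow k ((2 : k)⁻¹ • Z) b) d hWZ').symm
    _ = ∑ a ∈ range d, ∑ b ∈ range d, divPow k (X + Y) a * divPow k ((2 : k)⁻¹ • Z) b := by
        refine sum_congr rfl fun a _ ↦ ?_
        rw [sum_subset (range_subset_range.2 (show d ≤ 2 * d by omega)), sum_range_two_mul]
        · simp only [evenDivPow_two_mul, evenDivPow_two_mul_add_one, mul_zero, add_zero]
        · intro b _ hb
          exact hWZ' a b (by have := mem_range.not.1 hb; omega)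
    _ = ∑ n ∈ range d, ∑ p ∈ antidiagonal n,
          divPow k (X + Y) p.1 * divPow k ((2 : k)⁻¹ • Z) p.2 :=
        sum_range_sum_range_eq_sum_antidiagonal
          (fun a b ↦ divPow k (X + Y) a * divPow k ((2 : k)⁻¹ • Z) b) d
          fun a b h ↦ hWZ a b (by omega)
    _ = texp (X + Y + (2 : k)⁻¹ • Z) :=
        sum_congr rfl fun n hn ↦ (divPow_add hcomm (hfac n (mem_range.1 hn))).symm
end

section
/- Let k be a field of characteristic p > 0, d ≥ 1 with 2d ≤ p, and let X_0,…,X_M, Y_0,…,Y_M, Z_0,…,Z_M be d×d matrices over k such that: every X_i, Y_i, Z_i is nilpotent; Z_i = X_i*Y_i − Y_i*X_i, X_i*Z_i = Z_i*X_i and Y_i*Z_i = Z_i*Y_i for every i; and for all i ≠ j each of X_i, Y_i, Z_i commutes with each of X_j, Y_j, Z_j. For x, y, z ∈ k define M(x,y,z) := ∏_{i=0}^{M} exp( x^{p^i} • X_i + y^{p^i} • Y_i + (z^{p^i} − x^{p^i}·y^{p^i}/2) • Z_i ), where for a d×d matrix N we set exp(N) := Σ_{j=0}^{d−1} ((j!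 : k))⁻¹ • N^j and the product is taken in order of increasing i (the factors commute). Then M(0,0,0) = 1 and M(x,y,z) * M(r,s,t) = M(x+r, y+s, z + x*s + t) for all x, y, z, r, s, t ∈ k; that is, M is a d-dimensional representation of the Heisenberg group H₁(k). -/
/-- `M(x,y,z) = ∏_{i=0}^{Mn} exp(x^{p^i} • X_i + y^{p^i} • Y_i +
(z^{p^i} - x^{p^i} y^{p^i}/2) • Z_i)`, the product taken in order of increasing `i`. -/
noncomputable def heisMp {k : Type*} [Field k] {d : ℕ} (p Mn : ℕ)
    (X Y Z : Fin (Mn + 1) → Matrix (Fin d) (Fin d) k) (x y z : k) :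
    Matrix (Fin d) (Fin d) k :=
  (List.ofFn fun i : Fin (Mn + 1) =>
    texp (x ^ p ^ (i : ℕ) • X i + y ^ p ^ (i : ℕ) • Y i +
      (z ^ p ^ (i : ℕ) - x ^ p ^ (i : ℕ) * y ^ p ^ (i : ℕ) / 2) • Z i)).prod

open Finset in
/-- Leibniz rule for the convolution of two sequences. -/
lemma succ_nsmul_sum_antidiagonal {R : Type*} [Semiring R] (f g : ℕ → R) (n : ℕ) :
    (n + 1) • ∑ q ∈ antidiagonal (n + 1), f q.1 * g q.2 =
      ∑ q ∈ antidiagonal n, ((q.1 + 1) • f (q.1 + 1)) * g q.2 +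
        ∑ q ∈ antidiagonal n, f q.1 * ((q.2 + 1) • g (q.2 + 1)) := by
  have h : (n + 1) • ∑ q ∈ antidiagonal (n + 1), f q.1 * g q.2 =
      ∑ q ∈ antidiagonal (n + 1), (q.1 • f q.1) * g q.2 +
        ∑ q ∈ antidiagonal (n + 1), f q.1 * (q.2 • g q.2) := by
    rw [smul_sum, ← sum_add_distrib]
    refine sum_congr rfl fun q hq => ?_
    rw [← mem_antidiagonal.1 hq, add_smul, smul_mul_assoc, mul_smul_comm]
  rw [h, Nat.sum_antidiagonal_succ, Nat.sum_antidiagonal_succ' (n := n)]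
  simp

open Finset in
/-- If `f i ∈ W ^ i`, `g j ∈ W ^ j` and `W ^ d = 0`, the product of the sums of `f` and `g` is the
sum of their convolution. -/
lemma sum_mul_sum_eq_sum_antidiagonal {k R : Type*} [CommSemiring k] [Semiring R] [Algebra k R]
    {W : Submodule k R} {d : ℕ} (hW : ∀ n, d ≤ n → W ^ n = ⊥) {f g : ℕ → R}
    (hf : ∀ n, f n ∈ W ^ n) (hg : ∀ n, g n ∈ W ^ n) :
    (∑ i ∈ range d, f i) * ∑ j ∈ range d, g j =
      ∑ n ∈ range d, ∑ q ∈ antidiagonal n, f q.1 * g q.2 := by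
  have h : ∀ n, ∑ q ∈ antidiagonal n, f q.1 * g q.2 =
      ∑ i ∈ range (n + 1), f i * g (n - i) := fun n =>
    Nat.sum_antidiagonal_eq_sum_range_succ (fun i j => f i * g j) n
  simp_rw [h]
  rw [sum_range_diag_flip d fun i j => f i * g j, sum_mul_sum]
  refine sum_congr rfl fun i _ => (sum_subset (range_mono (Nat.sub_le d i)) ?_).symm
  intro j _ hj
  have hij : f i * g j ∈ W ^ (i + j) := by
    rw [pow_add]
    exact Submodule.mul_mem_mul (hf i) (hg j)
  rw [hW _ (by simp only [mem_range] at hj; omega)] at hij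
  simpa using hij

section DividedPower

variable (k : Type*) [Field k] {R : Type*} [Ring R] [Algebra k R]

/-- The divided power `(n!)⁻¹ • a ^ n`. -/
noncomputable def dividedPow (a : R) (n : ℕ) : R := ((n.factorial : k))⁻¹ • a ^ n

/-- The sequence of coefficients of `exp (t ^ 2 • a)`. -/
noncomputable def dividedPowSq (a : R) (n : ℕ) : R :=
  if Even n then dividedPow k a (n / 2) else 0

variable {k}

lemma dividedPow_mem {W : Submodule k R} {a : R} {w : ℕ} (ha : a ∈ W ^ w) (n : ℕ) :
    dividedPow k a n ∈ W ^ (w * n) := by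
  rw [pow_mul]
  exact Submodule.smul_mem _ _ (Submodule.pow_mem_pow _ ha n)

lemma dividedPowSq_mem {W : Submodule k R} {a : R} (ha : a ∈ W ^ 2) (n : ℕ) :
    dividedPowSq k a n ∈ W ^ n := by
  unfold dividedPowSq
  split_ifs with hn
  · simpa [Nat.two_mul_div_two_of_even hn] using dividedPow_mem ha (n / 2)
  · exact zero_mem _

lemma succ_nsmul_dividedPow (a : R) {n : ℕ} (hn : ((n + 1).factorial : k) ≠ 0) :
    (n + 1) • dividedPow k a (n + 1) = a * dividedPow k a n := by
  rw [Nat.factorial_succ, Nat.cast_mul] at hn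
  have h1 := left_ne_zero_of_mul hn
  rw [dividedPow, dividedPow, ← Nat.cast_smul_eq_nsmul k, smul_smul, mul_smul_comm, pow_succ',
    Nat.factorial_succ, Nat.cast_mul, mul_inv, mul_inv_cancel_left₀ h1]

lemma Commute.dividedPow_right {a b : R} (h : Commute a b) (n : ℕ) :
    Commute a (dividedPow k b n) :=
  (h.pow_right n).smul_right _

lemma add_two_nsmul_dividedPowSq (a : R) {n : ℕ} (hn : ((n + 2).factorial : k) ≠ 0) :
    (n + 2) • dividedPowSq k a (n + 2) = (2 * a) * dividedPowSq k a n := by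
  unfold dividedPowSq
  by_cases h : Even n
  · obtain ⟨m, rfl⟩ := h
    have h1 : (m + m + 2) / 2 = m + 1 := by omega
    have h2 : (m + m) / 2 = m := by omega
    have h3 : ((m + 1).factorial : k) ≠ 0 := fun h0 => hn <| by
      obtain ⟨c, hc⟩ := Nat.factorial_dvd_factorial (show m + 1 ≤ m + m + 2 by omega)
      rw [hc, Nat.cast_mul, h0, zero_mul]
    rw [if_pos (by simp [Nat.even_add]), if_pos (by simp), h1, h2, mul_assoc,
      ← succ_nsmul_dividedPow a h3, show m + m + 2 = 2 * (m + 1) by ring, mul_smul, two_mul,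
      two_smul]
  · have h' : ¬ Even (n + 2) := by simpa [Nat.even_add] using h
    simp [h, h']

open Finset in
lemma sum_dividedPowSq {W : Submodule k R} {d : ℕ} (hW : ∀ n, d ≤ n → W ^ n = ⊥) {a : R}
    (ha : a ∈ W ^ 2) :
    ∑ n ∈ range d, dividedPowSq k a n = ∑ n ∈ range d, dividedPow k a n := by
  have h : ∀ N, ∑ n ∈ range (2 * N), dividedPowSq k a n = ∑ n ∈ range N, dividedPow k a n := by
    intro N
    induction N with
    | zero => simp
    | succ N ih =>
      rw [mul_add, mul_one, sum_range_succ, sum_range_succ, ih, sum_range_succ]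
      simp [dividedPowSq]
  rw [← h d]
  refine sum_subset (range_mono (by omega)) fun n _ hn => ?_
  have := dividedPowSq_mem ha n
  rw [hW n (by simpa using hn)] at this
  simpa using this

lemma dividedPow_mul_of_commutator {a b c : R} (hc : a * b - b * a = c) (hac : Commute a c)
    {n : ℕ} (hn : ((n + 1).factorial : k) ≠ 0) :
    dividedPow k a (n + 1) * b = b * dividedPow k a (n + 1) + c * dividedPow k a n := by
  have hpow : ∀ m : ℕ, a ^ (m + 1) * b = b * a ^ (m + 1) + (m + 1) • (c * a ^ m) := by
    intro m
    have hab : a * b = b * a + c := by rw [← hc]; abel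
    induction m with
    | zero => simpa using hab
    | succ m ih =>
      rw [pow_succ' a (m + 1), mul_assoc, ih, mul_add, ← mul_assoc, hab, mul_smul_comm,
        ← mul_assoc a c, hac.eq, mul_assoc c a, ← pow_succ', add_mul, mul_assoc b,
        succ_nsmul _ (m + 1)]
      abel
  rw [Nat.factorial_succ, Nat.cast_mul] at hn
  have h1 := left_ne_zero_of_mul hn
  rw [dividedPow, dividedPow, smul_mul_assoc, hpow, smul_add, mul_smul_comm, mul_smul_comm,
    ← Nat.cast_smul_eq_nsmul k, smul_smul, Nat.factorial_succ, Nat.cast_mul, mul_inv_rev,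
    inv_mul_cancel_right₀ h1]

open Finset in
/-- The homogeneous components of `exp (t • a) * exp (t • b) = exp (t • (a + b)) * exp (t ^ 2 • c)`,
where `2 * c` is the commutator of `a` and `b`. -/
lemma sum_antidiagonal_dividedPow {a b c : R} (hc : a * b - b * a = 2 * c) (hac : Commute a c)
    (hbc : Commute b c) (n : ℕ) (hn : (n.factorial : k) ≠ 0) :
    ∑ q ∈ antidiagonal n, dividedPow k a q.1 * dividedPow k b q.2 =
      ∑ q ∈ antidiagonal n, dividedPow k (a + b) q.1 * dividedPowSq k c q.2 := by
  have hfac : ∀ {m n : ℕ}, m ≤ n → (n.factorial : k) ≠ 0 → (m.factorial : k) ≠ 0 := by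
    intro m n hmn hn h0
    obtain ⟨e, he⟩ := Nat.factorial_dvd_factorial hmn
    exact hn (by rw [he, Nat.cast_mul, h0, zero_mul])
  have hac2 : Commute a (2 * c) := (Commute.ofNat_right a 2).mul_right hac
  have hbc2 : Commute b (2 * c) := (Commute.ofNat_right b 2).mul_right hbc
  have hsc2 := hac2.add_left hbc2
  induction n using Nat.strong_induction_on with
  | _ n ih =>
  match n with
  | 0 => simp [dividedPow, dividedPowSq]
  | n + 1 =>
    have hL : (n + 1) • ∑ q ∈ antidiagonal (n + 1), dividedPow k a q.1 * dividedPow k b q.2 =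
        (∑ q ∈ antidiagonal n, a * (dividedPow k a q.1 * dividedPow k b q.2)) +
          ∑ q ∈ antidiagonal n, (dividedPow k a q.1 * b) * dividedPow k b q.2 := by
      rw [succ_nsmul_sum_antidiagonal]
      congr 1 <;> refine sum_congr rfl fun q hq => ?_ <;> have := mem_antidiagonal.1 hq
      · rw [succ_nsmul_dividedPow a (hfac (by omega) hn), mul_assoc]
      · rw [succ_nsmul_dividedPow b (hfac (by omega) hn), mul_assoc]
    have hR : (n + 1) • ∑ q ∈ antidiagonal (n + 1),
          dividedPow k (a + b) q.1 * dividedPowSq k c q.2 =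
        (a + b) * (∑ q ∈ antidiagonal n, dividedPow k (a + b) q.1 * dividedPowSq k c q.2) +
          ∑ q ∈ antidiagonal n,
            dividedPow k (a + b) q.1 * ((q.2 + 1) • dividedPowSq k c (q.2 + 1)) := by
      rw [succ_nsmul_sum_antidiagonal, mul_sum]
      congr 1
      refine sum_congr rfl fun q hq => ?_
      have := mem_antidiagonal.1 hq
      rw [succ_nsmul_dividedPow (a + b) (hfac (by omega) hn), mul_assoc]
    have hn1 : ((n + 1 : ℕ) : k) ≠ 0 := by
      rw [Nat.factorial_succ, Nat.cast_mul] at hn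
      exact left_ne_zero_of_mul hn
    have hcancel : ∀ u v : R, (n + 1) • u = (n + 1) • v → u = v := fun u v h => by
      rw [← Nat.cast_smul_eq_nsmul k, ← Nat.cast_smul_eq_nsmul k] at h
      exact smul_right_injective R hn1 h
    apply hcancel
    rw [hL, hR, ← mul_sum, ← ih n (by omega) (hfac (by omega) hn), add_mul, add_assoc]
    congr 1
    match n with
    | 0 => simp [dividedPow, dividedPowSq]
    | n + 1 =>
      have h1 : ∑ q ∈ antidiagonal (n + 1), (dividedPow k a q.1 * b) * dividedPow k b q.2 =
          b * (∑ q ∈ antidiagonal (n + 1), dividedPow k a q.1 * dividedPow k b q.2) +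
            (2 * c) * ∑ q ∈ antidiagonal n, dividedPow k a q.1 * dividedPow k b q.2 := by
        rw [Nat.sum_antidiagonal_succ, Nat.sum_antidiagonal_succ, mul_add, add_assoc, mul_sum,
          mul_sum, ← sum_add_distrib]
        congr 1
        · simp [dividedPow]
        · refine sum_congr rfl fun q hq => ?_
          have := mem_antidiagonal.1 hq
          rw [dividedPow_mul_of_commutator hc hac2 (hfac (by omega) hn), add_mul, mul_assoc,
            mul_assoc]
      rw [h1, ih n (by omega) (hfac (by omega) hn)]
      congr 1
      have h0 : dividedPowSq k c 1 = 0 := by simp [dividedPowSq]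
      rw [Nat.sum_antidiagonal_succ', mul_sum, zero_add, h0, smul_zero, mul_zero, zero_add]
      refine sum_congr rfl fun q hq => ?_
      have := mem_antidiagonal.1 hq
      rw [add_two_nsmul_dividedPowSq c (hfac (by omega) hn), ← mul_assoc, ← mul_assoc,
        (hsc2.symm.dividedPow_right _).eq]

open Finset in
/-- A truncated Baker–Campbell–Hausdorff formula for a commutator `2 * c` that commutes with both
arguments. -/
lemma sum_dividedPow_mul_sum_dividedPow {W : Submodule k R} {d : ℕ} (hW : W ^ d = ⊥)
    (hfac : ∀ n < d, (n.factorial : k) ≠ 0) {a b c : R} (ha : a ∈ W) (hb : b ∈ W)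
    (hcW : c ∈ W ^ 2) (hc : a * b - b * a = 2 * c) (hac : Commute a c) (hbc : Commute b c) :
    (∑ n ∈ range d, dividedPow k a n) * ∑ n ∈ range d, dividedPow k b n =
      (∑ n ∈ range d, dividedPow k (a + b) n) * ∑ n ∈ range d, dividedPow k c n := by
  have hW' : ∀ n, d ≤ n → W ^ n = ⊥ := fun n hn => by
    rw [← Nat.add_sub_cancel' hn, pow_add, hW, Submodule.bot_mul]
  have hmem : ∀ {e : R}, e ∈ W → ∀ n, dividedPow k e n ∈ W ^ n := fun he n => by
    simpa using dividedPow_mem (w := 1) (by simpa using he) n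
  rw [← sum_dividedPowSq hW' hcW, sum_mul_sum_eq_sum_antidiagonal hW' (hmem ha) (hmem hb),
    sum_mul_sum_eq_sum_antidiagonal hW' (hmem (add_mem ha hb)) (dividedPowSq_mem hcW)]
  exact sum_congr rfl fun n hn =>
    sum_antidiagonal_dividedPow hc hac hbc n (hfac n (mem_range.1 hn))

end DividedPower

section Nilpotency

variable {k V : Type*} [Field k] [AddCommGroup V] [Module k V]

lemma IsNilpotent.exists_apply_mem {T : Module.End k V} (hT : IsNilpotent T) {K : Submodule k V}
    {P : V → Prop} (hP : ∀ v, P v → P (T v)) {u : V} (hu : P u) (huK : u ∉ K) :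
    ∃ v, P v ∧ v ∉ K ∧ T v ∈ K := by
  by_contra! h
  have hpow : ∀ n : ℕ, P ((T ^ n) u) ∧ (T ^ n) u ∉ K := by
    intro n
    induction n with
    | zero => exact ⟨hu, huK⟩
    | succ n ih =>
      rw [pow_succ', Module.End.mul_apply]
      exact ⟨hP _ ih.1, h _ ih.1 ih.2⟩
  obtain ⟨n, hn⟩ := hT
  exact (hpow n).2 (by simp [hn])

/-- The `n`-th term of the ascending chain of subspaces killed by words in `X, Y, Z`. -/
def heisKer (X Y Z : Module.End k V) : ℕ → Submodule k V
  | 0 => ⊥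
  | n + 1 => (heisKer X Y Z n).comap X ⊓ (heisKer X Y Z n).comap Y ⊓ (heisKer X Y Z n).comap Z

lemma heisKer_le_succ (X Y Z : Module.End k V) (n : ℕ) :
    heisKer X Y Z n ≤ heisKer X Y Z (n + 1) := by
  induction n with
  | zero => exact bot_le
  | succ n ih =>
    exact inf_le_inf (inf_le_inf (Submodule.comap_mono ih) (Submodule.comap_mono ih))
      (Submodule.comap_mono ih)

lemma heisKer_lt_succ {X Y Z : Module.End k V} (hX : IsNilpotent X) (hY : IsNilpotent Y)
    (hZ : IsNilpotent Z) (hXY : Z = X * Y - Y * X) (hXZ : Commute X Z) (hYZ : Commute Y Z)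
    {n : ℕ} (hn : heisKer X Y Z n ≠ ⊤) : heisKer X Y Z n < heisKer X Y Z (n + 1) := by
  refine lt_of_le_of_ne (heisKer_le_succ X Y Z n) fun heq => ?_
  have hinv := heisKer_le_succ X Y Z n
  set K := heisKer X Y Z n with hK
  have hXK : ∀ v ∈ K, X v ∈ K := fun v hv => (hinv hv).1.1
  have hYK : ∀ v ∈ K, Y v ∈ K := fun v hv => (hinv hv).1.2
  obtain ⟨u, hu⟩ : ∃ u, u ∉ K := by
    by_contra! h
    exact hn (eq_top_iff.2 fun v _ => h v)
  have hZX : ∀ v, Z (X v) = X (Z v) := fun v => (LinearMap.congr_fun hXZ.eq v).symm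
  have hZY : ∀ v, Z (Y v) = Y (Z v) := fun v => (LinearMap.congr_fun hYZ.eq v).symm
  have hXYv : ∀ v, X (Y v) = Y (X v) + Z v := fun v => by simp [hXY]
  obtain ⟨v₁, -, hv₁, hZ₁⟩ := hZ.exists_apply_mem (P := fun _ => True) (by simp) trivial hu
  obtain ⟨v₂, hZ₂, hv₂, hX₂⟩ := hX.exists_apply_mem (P := fun v => Z v ∈ K)
    (fun v hv => by rw [hZX]; exact hXK _ hv) hZ₁ hv₁
  obtain ⟨v₃, h₃, hv₃, hY₃⟩ := hY.exists_apply_mem (P := fun v => Z v ∈ K ∧ X v ∈ K)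
    (fun v hv => by
      rw [hZY, hXYv]
      exact ⟨hYK _ hv.1, add_mem (hYK _ hv.2) hv.1⟩) ⟨hZ₂, hX₂⟩ hv₂
  refine hv₃ (heq ▸ ?_)
  exact ⟨⟨h₃.2, hY₃⟩, h₃.1⟩

lemma apply_eq_zero_of_mem_heisKer (X Y Z : Module.End k V) {n : ℕ} {w : Module.End k V}
    (hw : w ∈ Submodule.span k {X, Y, Z} ^ n) {v : V} (hv : v ∈ heisKer X Y Z n) : w v = 0 := by
  induction n generalizing w v with
  | zero =>
    have hv0 : v = 0 := hv
    rw [hv0, map_zero]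
  | succ n ih =>
    rw [pow_succ] at hw
    induction hw using Submodule.mul_induction_on' with
    | mem_mul_mem m hm e he =>
      refine ih hm ?_
      induction he using Submodule.span_induction with
      | mem e he =>
        rcases he with rfl | rfl | rfl
        exacts [hv.1.1, hv.1.2, hv.2]
      | zero => exact zero_mem _
      | add e f _ _ he hf => exact add_mem he hf
      | smul r e _ he => exact Submodule.smul_mem _ r he
    | add e _ f _ he hf => rw [LinearMap.add_apply, he, hf, add_zero]

open Module in
/-- The operators of a nilpotent Heisenberg triple generate a nilpotent associative algebra. -/
lemma span_heisenberg_pow_finrank_eq_bot [FiniteDimensional k V] {X Y Z : Module.End k V}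
    (hX : IsNilpotent X) (hY : IsNilpotent Y) (hZ : IsNilpotent Z) (hXY : Z = X * Y - Y * X)
    (hXZ : Commute X Z) (hYZ : Commute Y Z) :
    Submodule.span k {X, Y, Z} ^ finrank k V = ⊥ := by
  have hrank : ∀ n, heisKer X Y Z n = ⊤ ∨ n ≤ finrank k (heisKer X Y Z n) := by
    intro n
    induction n with
    | zero => exact Or.inr (Nat.zero_le _)
    | succ n ih =>
      by_cases h : heisKer X Y Z n = ⊤
      · exact Or.inl (top_le_iff.1 (h ▸ heisKer_le_succ X Y Z n))
      · have := Submodule.finrank_lt_finrank_of_lt (heisKer_lt_succ hX hY hZ hXY hXZ hYZ h)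
        have := ih.resolve_left h
        exact Or.inr (by omega)
  have htop : heisKer X Y Z (finrank k V) = ⊤ := (hrank _).elim id fun h =>
    Submodule.eq_top_of_finrank_eq (le_antisymm (Submodule.finrank_le _) h)
  refine eq_bot_iff.2 fun w hw => ?_
  rw [Submodule.mem_bot]
  ext v
  exact apply_eq_zero_of_mem_heisKer X Y Z hw (htop ▸ Submodule.mem_top)

end Nilpotency

section Matrices

variable {k : Type*} [Field k] {d : ℕ}

lemma span_matrix_heisenberg_pow_eq_bot {X Y Z : Matrix (Fin d) (Fin d) k}
    (hX : IsNilpotent X) (hY : IsNilpotent Y) (hZ : IsNilpotent Z) (hXY : Z = X * Y - Y * X)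
    (hXZ : Commute X Z) (hYZ : Commute Y Z) : Submodule.span k {X, Y, Z} ^ d = ⊥ := by
  let φ : Matrix (Fin d) (Fin d) k ≃ₐ[k] Module.End k (Fin d → k) := Matrix.toLinAlgEquiv'
  have h := span_heisenberg_pow_finrank_eq_bot (hX.map φ) (hY.map φ) (hZ.map φ)
    (by rw [hXY, map_sub, map_mul, map_mul]) (hXZ.map φ) (hYZ.map φ)
  rw [Module.finrank_fin_fun] at h
  have himg : ({φ X, φ Y, φ Z} : Set _) = φ.toAlgHom.toLinearMap '' {X, Y, Z} := by
    simp [Set.image_insert_eq]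
  rw [himg, ← Submodule.map_span, ← Submodule.map_pow] at h
  exact Submodule.map_injective_of_injective (f := φ.toAlgHom.toLinearMap) φ.injective
    (h.trans (Submodule.map_bot _).symm)

lemma texp_zero (hd : 1 ≤ d) : texp (0 : Matrix (Fin d) (Fin d) k) = 1 := by
  rw [texp, Finset.sum_eq_single_of_mem 0 (Finset.mem_range.2 hd) fun j _ hj => by simp [hj]]
  simp

lemma Commute.texp {A B : Matrix (Fin d) (Fin d) k} (h : Commute A B) :
    Commute (texp A) (texp B) :=
  Commute.sum_left _ _ _ fun i _ => Commute.sum_right _ _ _ fun j _ =>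
    ((h.pow_pow i j).smul_right _).smul_left _

/-- The Heisenberg group law for a single layer. -/
lemma texp_mul_texp_heisenberg (hd : 1 ≤ d) (hfac : ∀ n < d, (n.factorial : k) ≠ 0)
    (h2 : (2 : k) ≠ 0) {X Y Z : Matrix (Fin d) (Fin d) k}
    (hX : IsNilpotent X) (hY : IsNilpotent Y) (hZ : IsNilpotent Z) (hXY : Z = X * Y - Y * X)
    (hXZ : Commute X Z) (hYZ : Commute Y Z) (x y z r s t : k) :
    texp (x • X + y • Y + (z - x * y / 2) • Z) * texp (r • X + s • Y + (t - r * s / 2) • Z) =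
      texp ((x + r) • X + (y + s) • Y + (z + x * s + t - (x + r) * (y + s) / 2) • Z) := by
  have hW := span_matrix_heisenberg_pow_eq_bot hX hY hZ hXY hXZ hYZ
  set W := Submodule.span k {X, Y, Z}
  have hXW : X ∈ W := Submodule.subset_span (by simp)
  have hYW : Y ∈ W := Submodule.subset_span (by simp)
  have hZW : Z ∈ W := Submodule.subset_span (by simp)
  have hZW2 : Z ∈ W ^ 2 := by
    rw [hXY, pow_two]
    exact sub_mem (Submodule.mul_mem_mul hXW hYW) (Submodule.mul_mem_mul hYW hXW)
  have hmem : ∀ a b c : k, a • X + b • Y + c • Z ∈ W := fun a b c =>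
    add_mem (add_mem (W.smul_mem a hXW) (W.smul_mem b hYW)) (W.smul_mem c hZW)
  have hcz : ∀ a b c e : k, Commute (a • X + b • Y + c • Z) (e • Z) := fun a b c e =>
    (((hXZ.smul_left a).add_left (hYZ.smul_left b)).add_left
      ((Commute.refl Z).smul_left c)).smul_right e
  set C := ((x * s - y * r) / 2) • Z with hC
  set A := x • X + y • Y + (z - x * y / 2) • Z with hA
  set B := r • X + s • Y + (t - r * s / 2) • Z with hB
  have hcomm : A * B - B * A = 2 * C := by
    have := NeZero.mk h2
    have h2C : 2 * C = (x * s - y * r) • Z := by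
      rw [two_mul, hC, ← add_smul, add_halves]
    have hXZ' := hXZ.eq
    have hYZ' := hYZ.eq
    have hYX : Y * X = X * Y - Z := by rw [hXY]; abel
    rw [h2C, hA, hB]
    simp only [add_mul, mul_add, smul_mul_assoc, mul_smul_comm, hXZ', hYZ', hYX]
    module
  have hAC : Commute A C := hcz _ _ _ _
  have hBC : Commute B C := hcz _ _ _ _
  have hAB := sum_dividedPow_mul_sum_dividedPow hW hfac (hmem _ _ _) (hmem _ _ _)
    (Submodule.smul_mem _ _ hZW2) hcomm hAC hBC
  have hSC := sum_dividedPow_mul_sum_dividedPow hW hfac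
    (add_mem (hmem x y (z - x * y / 2)) (hmem r s (t - r * s / 2)))
    (W.smul_mem ((x * s - y * r) / 2) hZW) (zero_mem _)
    (by rw [mul_zero, sub_eq_zero]; exact (hAC.add_left hBC).eq) (Commute.zero_right _) (Commute.zero_right _)
  have h : texp A * texp B = texp (A + B + C) * texp 0 := hAB.trans hSC
  rw [h, texp_zero hd, mul_one, hA, hB, hC]
  congr 1
  (match_scalars <;> field_simp); ring

end Matrices

lemma List.prod_ofFn_mul_prod_ofFn {R : Type*} [Monoid R] {n : ℕ} (f g : Fin n → R)
    (h : ∀ i j, i ≠ j → Commute (f i) (g j)) :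
    (List.ofFn f).prod * (List.ofFn g).prod = (List.ofFn fun i => f i * g i).prod := by
  induction n with
  | zero => simp
  | succ n ih =>
    simp only [List.ofFn_succ, List.prod_cons]
    rw [← ih _ _ fun i j hij => h _ _ fun he => hij (Fin.succ_injective n he)]
    have hc : Commute (List.ofFn fun i => f i.succ).prod (g 0) :=
      Commute.list_prod_left _ _ fun a ha => by
        obtain ⟨i, rfl⟩ := List.mem_ofFn.1 ha
        exact h _ _ (Fin.succ_ne_zero i)
    rw [mul_assoc, ← mul_assoc _ (g 0), hc.eq, mul_assoc, mul_assoc]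

/-- In characteristic `p > 0` with `2d ≤ p`, a family of nilpotent matrices
`X_i, Y_i, Z_i` (`i = 0, …, Mn`) with `Z_i = [X_i, Y_i]`, `[X_i, Z_i] = [Y_i, Z_i] = 0`,
and all matrices of distinct layers commuting, defines a `d`-dimensional representation of
the Heisenberg group `H₁(k)` via
`M(x,y,z) = ∏ i, exp(x^{p^i} • X_i + y^{p^i} • Y_i + (z^{p^i} - x^{p^i} y^{p^i}/2) • Z_i)`:
`M(0,0,0) = 1` and `M(x,y,z) * M(r,s,t) = M(x+r, y+s, z + x*s + t)`. -/
theorem stmt19 (k : Type*) [Field k] (p : ℕ) [CharP k p] (hp : 0 < p)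
    (d : ℕ) (hd : 1 ≤ d) (hpd : 2 * d ≤ p) (Mn : ℕ)
    (X Y Z : Fin (Mn + 1) → Matrix (Fin d) (Fin d) k)
    (hXnil : ∀ i, IsNilpotent (X i)) (hYnil : ∀ i, IsNilpotent (Y i))
    (hZnil : ∀ i, IsNilpotent (Z i))
    (hZdef : ∀ i, Z i = X i * Y i - Y i * X i)
    (hXZ : ∀ i, X i * Z i = Z i * X i) (hYZ : ∀ i, Y i * Z i = Z i * Y i)
    (hcomm : ∀ i j, i ≠ j →
      Commute (X i) (X j) ∧ Commute (X i) (Y j) ∧ Commute (X i) (Z j) ∧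
      Commute (Y i) (X j) ∧ Commute (Y i) (Y j) ∧ Commute (Y i) (Z j) ∧
      Commute (Z i) (X j) ∧ Commute (Z i) (Y j) ∧ Commute (Z i) (Z j)) :
    heisMp p Mn X Y Z 0 0 0 = 1 ∧
    ∀ x y z r s t : k,
      heisMp p Mn X Y Z x y z * heisMp p Mn X Y Z r s t =
        heisMp p Mn X Y Z (x + r) (y + s) (z + x * s + t) := by
  have hprime : p.Prime := (CharP.char_is_prime_or_zero k p).resolve_right hp.ne'
  have : Fact p.Prime := ⟨hprime⟩
  have hfac : ∀ n < d, (n.factorial : k) ≠ 0 := fun n hn h => by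
    rw [CharP.cast_eq_zero_iff k p, hprime.dvd_factorial] at h
    omega
  constructor
  · unfold heisMp
    rw [List.prod_eq_one]
    intro a ha
    obtain ⟨i, rfl⟩ := List.mem_ofFn.1 ha
    have h0 : (0 : k) ^ p ^ (i : ℕ) = 0 := zero_pow (pow_ne_zero _ hp.ne')
    simp only [h0, zero_smul, mul_zero, zero_div, sub_zero, add_zero, texp_zero hd]
  intro x y z r s t
  unfold heisMp
  rw [List.prod_ofFn_mul_prod_ofFn]
  · congr 2
    funext i
    have hadd : ∀ a b : k, (a + b) ^ p ^ (i : ℕ) = a ^ p ^ (i : ℕ) + b ^ p ^ (i : ℕ) :=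
      fun a b => add_pow_char_pow a b p i
    simp only [hadd, mul_pow]
    by_cases h2 : (2 : k) = 0
    · obtain rfl : d = 1 := by
        have : p ∣ 2 := (CharP.cast_eq_zero_iff k p 2).1 (by exact_mod_cast h2)
        have := Nat.le_of_dvd two_pos this
        omega
      have hbot := span_matrix_heisenberg_pow_eq_bot (hXnil i) (hYnil i) (hZnil i) (hZdef i)
        (hXZ i) (hYZ i)
      rw [pow_one, Submodule.span_eq_bot] at hbot
      rw [hbot (X i) (by simp), hbot (Y i) (by simp), hbot (Z i) (by simp)]
      simp [texp_zero]
    · exact texp_mul_texp_heisenberg hd hfac h2 (hXnil i) (hYnil i) (hZnil i) (hZdef i)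
        (hXZ i) (hYZ i) _ _ _ _ _ _
  · intro i j hij
    obtain ⟨h1, h2, h3, h4, h5, h6, h7, h8, h9⟩ := hcomm i j hij
    have hlin : ∀ {A : Matrix (Fin d) (Fin d) k}, Commute A (X j) → Commute A (Y j) →
        Commute A (Z j) → ∀ a b c : k, Commute A (a • X j + b • Y j + c • Z j) :=
      fun hX hY hZ a b c =>
        ((hX.smul_right a).add_right (hY.smul_right b)).add_right (hZ.smul_right c)
    exact Commute.texp (Commute.add_left (Commute.add_left
      ((hlin h1 h2 h3 _ _ _).smul_left _) ((hlin h4 h5 h6 _ _ _).smul_left _))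
      ((hlin h7 h8 h9 _ _ _).smul_left _))
end
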